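/- arXiv:0907.4450 — 11 statements merged into one kernel-verified Lean document; each statement's English description precedes it below -/
import Mathlib

section
/- Let (W,W') be an exchangeable pair with E(W−W'|W) = 1/c₀ + r(W), where c₀ > 0 is a constant, and set Δ = W − W'. Let Y be exponentially distributed with mean 1. Then for every absolutely continuous function h: ℝ → ℝ with ‖h'‖ := sup_x |h'(x)| < ∞, one has |E h(W) − E h(Y)| ≤ ‖h'‖·{ E|1 − (c₀/2)E(Δ²|W)| + c₀·E|Δ|³ + 3·c₀·E|W·r(W)| }. -/
open MeasureTheory

section LipschitzExponential

variable {h : ℝ → ℝ} {B : ℝ}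

theorem continuous_of_abs_sub_le (hB : 0 ≤ B) (hL : ∀ x y, |h y - h x| ≤ B * |y - x|) :
    Continuous h := by
  refine LipschitzWith.continuous (K := ⟨B, hB⟩) (LipschitzWith.of_dist_le_mul fun x y => ?_)
  exact hL y x

theorem integrableOn_id_mul_exp_neg :
    IntegrableOn (fun x : ℝ => x * Real.exp (-x)) (Set.Ioi 0) := by
  have key := Real.GammaIntegral_convergent (s := 2) (by norm_num)
  refine key.congr_fun (fun x _ => ?_) measurableSet_Ioi
  norm_num [mul_comm]

theorem integrableOn_comp_add_mul_exp_neg (hB : 0 ≤ B)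
    (hL : ∀ x y, |h y - h x| ≤ B * |y - x|) (w : ℝ) :
    IntegrableOn (fun x => h (w + x) * Real.exp (-x)) (Set.Ioi 0) := by
  have hc := continuous_of_abs_sub_le hB hL
  have hdom : IntegrableOn
      (fun x : ℝ => |h w| * Real.exp (-x) + B * (x * Real.exp (-x))) (Set.Ioi 0) :=
    ((integrableOn_exp_neg_Ioi 0).const_mul _).add (integrableOn_id_mul_exp_neg.const_mul _)
  refine Integrable.mono' hdom (by fun_prop) ?_
  filter_upwards [ae_restrict_mem measurableSet_Ioi] with x hx
  have hx' : 0 < x := hx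
  have hlip := hL w (w + x)
  rw [add_sub_cancel_left, abs_of_pos hx'] at hlip
  have htri : |h (w + x)| ≤ |h w| + B * x := by
    have := abs_sub_abs_le_abs_sub (h (w + x)) (h w)
    linarith
  rw [Real.norm_eq_abs, abs_mul, Real.abs_exp]
  nlinarith [Real.exp_pos (-x)]

/-- The shifted exponential expectation of a Lipschitz function is Lipschitz. -/
theorem abs_integral_comp_add_mul_exp_neg_sub_le (hB : 0 ≤ B)
    (hL : ∀ x y, |h y - h x| ≤ B * |y - x|) (u v : ℝ) :
    |(∫ x in Set.Ioi (0 : ℝ), h (v + x) * Real.exp (-x))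
      - ∫ x in Set.Ioi (0 : ℝ), h (u + x) * Real.exp (-x)| ≤ B * |v - u| := by
  rw [← integral_sub (integrableOn_comp_add_mul_exp_neg hB hL v)
    (integrableOn_comp_add_mul_exp_neg hB hL u)]
  calc |∫ x in Set.Ioi (0 : ℝ),
          (h (v + x) * Real.exp (-x) - h (u + x) * Real.exp (-x))|
      ≤ ∫ x in Set.Ioi (0 : ℝ), B * |v - u| * Real.exp (-x) := by
        rw [← Real.norm_eq_abs]
        refine norm_integral_le_of_norm_le ((integrableOn_exp_neg_Ioi 0).const_mul _)
          (Filter.Eventually.of_forall fun x => ?_)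
        rw [← sub_mul, Real.norm_eq_abs, abs_mul, Real.abs_exp]
        have := hL (u + x) (v + x)
        rw [add_sub_add_right_eq_sub] at this
        gcongr
    _ = B * |v - u| := by
        rw [integral_const_mul, integral_exp_neg_Ioi_zero, mul_one]

theorem integral_comp_add_mul_exp_neg (h : ℝ → ℝ) (w : ℝ) :
    ∫ x in Set.Ioi (0 : ℝ), h (w + x) * Real.exp (-x)
      = Real.exp w * ∫ x in Set.Ioi w, h x * Real.exp (-x) := by
  have key := (measurePreserving_add_left volume w).setIntegral_preimage_emb
    (measurableEmbedding_addLeft w)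
    (fun x => h x * Real.exp (-x)) (Set.Ioi w)
  have hpre : (fun x => w + x) ⁻¹' Set.Ioi w = Set.Ioi (0 : ℝ) := by
    ext x; simp
  rw [hpre] at key
  rw [← key, ← integral_const_mul]
  refine integral_congr_ae (Filter.Eventually.of_forall fun x => ?_)
  simp only [neg_add, Real.exp_add, Real.exp_neg w]
  field_simp

theorem hasDerivAt_integral_comp_add_mul_exp_neg (hB : 0 ≤ B)
    (hL : ∀ x y, |h y - h x| ≤ B * |y - x|) (w : ℝ) :
    HasDerivAt (fun w => ∫ x in Set.Ioi (0 : ℝ), h (w + x) * Real.exp (-x))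
      ((∫ x in Set.Ioi (0 : ℝ), h (w + x) * Real.exp (-x)) - h w) w := by
  have hc := continuous_of_abs_sub_le hB hL
  have hφc : Continuous fun x => h x * Real.exp (-x) := by fun_prop
  have hφ : IntegrableOn (fun x => h x * Real.exp (-x)) (Set.Ioi 0) := by
    simpa using integrableOn_comp_add_mul_exp_neg hB hL 0
  have hsplit : ∀ u, ∫ x in Set.Ioi u, h x * Real.exp (-x)
      = (∫ x in Set.Ioi (0 : ℝ), h x * Real.exp (-x)) - ∫ x in (0 : ℝ)..u, h x * Real.exp (-x) := by
    intro u
    have hu : IntegrableOn (fun x => h x * Real.exp (-x)) (Set.Ioi u) := by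
      refine IntegrableOn.mono_set
        (((hφc.integrableOn_Icc (a := u) (b := 0))).union hφ) fun x hx => ?_
      rcases le_or_gt x 0 with h0 | h0
      · exact Or.inl ⟨le_of_lt hx, h0⟩
      · exact Or.inr h0
    rw [← intervalIntegral.integral_interval_add_Ioi hφ hu]
    ring
  have hd : HasDerivAt (fun u => ∫ x in (0 : ℝ)..u, h x * Real.exp (-x))
      (h w * Real.exp (-w)) w := (hφc.integral_hasStrictDerivAt 0 w).hasDerivAt
  have hfun : (fun w => ∫ x in Set.Ioi (0 : ℝ), h (w + x) * Real.exp (-x)) = fun w =>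
      Real.exp w * ((∫ x in Set.Ioi (0 : ℝ), h x * Real.exp (-x))
        - ∫ x in (0 : ℝ)..w, h x * Real.exp (-x)) := by
    funext u
    rw [integral_comp_add_mul_exp_neg, hsplit]
  rw [congrFun hfun w, hfun]
  refine ((Real.hasDerivAt_exp w).mul (hd.const_sub _)).congr_deriv ?_
  rw [Real.exp_neg]
  field_simp
  ring

/-- Lipschitz test functions admit a regular solution of the Stein equation of the
exponential law. -/
theorem exists_exponential_stein_solution (hB : 0 ≤ B)
    (hL : ∀ x y, |h y - h x| ≤ B * |y - x|) :
    ∃ f f' : ℝ → ℝ, (∀ w, HasDerivAt f (f' w) w)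
      ∧ (∀ w, f' w - f w = h w - ∫ x in Set.Ioi (0 : ℝ), h x * Real.exp (-x))
      ∧ (∀ w, |f w| ≤ B * |w|) ∧ (∀ x y, |f y - f x| ≤ B * |y - x|)
      ∧ (∀ w, |f' w| ≤ B) ∧ ∀ x y, |f' y - f' x| ≤ 2 * B * |y - x| := by
  set G : ℝ → ℝ := fun w => ∫ x in Set.Ioi (0 : ℝ), h (w + x) * Real.exp (-x) with hG
  have hGlip : ∀ x y, |G y - G x| ≤ B * |y - x| :=
    abs_integral_comp_add_mul_exp_neg_sub_le hB hL
  have hG0 : G 0 = ∫ x in Set.Ioi (0 : ℝ), h x * Real.exp (-x) := by simp [hG]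
  have hderiv : ∀ w, HasDerivAt G (G w - h w) w :=
    hasDerivAt_integral_comp_add_mul_exp_neg hB hL
  refine ⟨fun w => G 0 - G w, fun w => h w - G w, fun w => ?_, fun w => ?_, fun w => ?_,
    fun x y => ?_, fun w => ?_, fun x y => ?_⟩
  · simpa using (hderiv w).const_sub (G 0)
  · rw [← hG0]; ring
  · simpa [abs_sub_comm] using hGlip w 0
  · rw [sub_sub_sub_cancel_left, abs_sub_comm]; exact hGlip x y
  · rw [abs_sub_comm]
    exact (hderiv w).le_of_lip' hB (Filter.Eventually.of_forall fun x => hGlip w x)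
  · calc |h y - G y - (h x - G x)| = |(h y - h x) - (G y - G x)| := by ring_nf
      _ ≤ |h y - h x| + |G y - G x| := abs_sub _ _
      _ ≤ 2 * B * |y - x| := by linarith [hL x y, hGlip x y]

end LipschitzExponential

/-- First-order Taylor estimate for a function with Lipschitz derivative. -/
theorem abs_sub_sub_deriv_mul_le {f f' : ℝ → ℝ} {K : ℝ} (hK : 0 ≤ K)
    (hf : ∀ x, HasDerivAt f (f' x) x) (hL : ∀ x y, |f' y - f' x| ≤ K * |y - x|) (x y : ℝ) :
    |f x - f y - f' x * (x - y)| ≤ K * |x - y| * |x - y| := by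
  have hd : ∀ z ∈ Set.uIcc x y,
      HasDerivWithinAt (fun z => f z - f' x * z) (f' z - f' x) (Set.uIcc x y) z := by
    intro z _
    exact (((hf z).sub ((hasDerivAt_id z).const_mul (f' x))).congr_deriv
      (by ring)).hasDerivWithinAt
  have hb : ∀ z ∈ Set.uIcc x y, ‖f' z - f' x‖ ≤ K * |x - y| := by
    intro z hz
    refine (hL x z).trans (mul_le_mul_of_nonneg_left ?_ hK)
    rw [abs_sub_comm x y]
    exact Set.abs_sub_left_of_mem_uIcc hz
  have key := Convex.norm_image_sub_le_of_norm_hasDerivWithin_le hd hb (convex_uIcc x y)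
    Set.right_mem_uIcc Set.left_mem_uIcc
  simp only [Real.norm_eq_abs] at key
  convert key using 2
  ring

theorem integral_comp_of_map_eq_exponential {Ω : Type*} [MeasurableSpace Ω] {μ : Measure Ω}
    {Y : Ω → ℝ} (hY : Measurable Y)
    (hYdens : μ.map Y
      = volume.withDensity
          (fun x => ENNReal.ofReal (if 0 < x then Real.exp (-x) else 0)))
    {h : ℝ → ℝ} (hh : Measurable h) :
    ∫ ω, h (Y ω) ∂μ = ∫ x in Set.Ioi (0 : ℝ), h x * Real.exp (-x) := by
  rw [← integral_map hY.aemeasurable hh.aestronglyMeasurable, hYdens,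
    integral_withDensity_eq_integral_toReal_smul, ← integral_indicator measurableSet_Ioi]
  · refine integral_congr_ae (Filter.Eventually.of_forall fun x => ?_)
    by_cases hx : 0 < x
    · simp [hx, Set.indicator, mul_comm, (Real.exp_pos (-x)).le]
    · simp [hx, Set.indicator]
  · exact (Measurable.ite measurableSet_Ioi (by fun_prop) measurable_const).ennreal_ofReal
  · simp

theorem integral_mul_condExp_of_bounded {Ω : Type*} {m mΩ : MeasurableSpace Ω} {μ : Measure Ω}
    [IsFiniteMeasure μ] (hm : m ≤ mΩ)
    {f g : Ω → ℝ} (hf : StronglyMeasurable[m] f) {C : ℝ} (hC : ∀ ω, |f ω| ≤ C)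
    (hg : Integrable g μ) :
    ∫ ω, f ω * (μ[g | m]) ω ∂μ = ∫ ω, f ω * g ω ∂μ := by
  have hfg : Integrable (f * g) μ :=
    hg.bdd_mul (hf.mono hm).aestronglyMeasurable (Filter.Eventually.of_forall hC)
  have hae := condExp_mul_of_stronglyMeasurable_left hf hfg hg
  have h1 : ∫ ω, f ω * (μ[g | m]) ω ∂μ = ∫ ω, (μ[f * g | m]) ω ∂μ := (integral_congr_ae hae).symm
  rw [h1, integral_condExp hm]
  rfl

section ExchangeablePair

variable {Ω : Type*} [MeasurableSpace Ω] {μ : Measure Ω} {W W' : Ω → ℝ}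

theorem two_mul_integral_sub_mul_of_exchangeable (hW : Measurable W) (hW' : Measurable W')
    (hWint : Integrable W μ) (hW'int : Integrable W' μ)
    (hexch : μ.map (fun ω => (W ω, W' ω)) = μ.map (fun ω => (W' ω, W ω)))
    {F : ℝ → ℝ} (hF : Measurable F) {C : ℝ} (hC : ∀ x, |F x| ≤ C) :
    2 * ∫ ω, F (W ω) * (W ω - W' ω) ∂μ = ∫ ω, (W ω - W' ω) * (F (W ω) - F (W' ω)) ∂μ := by
  have hi : ∀ V : Ω → ℝ, Measurable V → Integrable (fun ω => F (V ω) * (W ω - W' ω)) μ :=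
    fun V hV => (hWint.sub hW'int).bdd_mul (hF.comp hV).aestronglyMeasurable
      (Filter.Eventually.of_forall fun ω => hC (V ω))
  have hg : Measurable fun p : ℝ × ℝ => F p.1 * (p.1 - p.2) := by fun_prop
  have hswap : ∫ ω, F (W ω) * (W ω - W' ω) ∂μ = ∫ ω, F (W' ω) * (W' ω - W ω) ∂μ := by
    have e1 := integral_map (μ := μ) (hW.prodMk hW').aemeasurable hg.aestronglyMeasurable
    have e2 := integral_map (μ := μ) (hW'.prodMk hW).aemeasurable hg.aestronglyMeasurable
    exact e1.symm.trans ((congrArg (fun ν => ∫ p, F p.1 * (p.1 - p.2) ∂ν) hexch).trans e2)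
  have hneg : ∫ ω, F (W' ω) * (W' ω - W ω) ∂μ = -∫ ω, F (W' ω) * (W ω - W' ω) ∂μ := by
    rw [← integral_neg]
    exact integral_congr_ae (Filter.Eventually.of_forall fun ω => by ring)
  have hsub := integral_sub (hi W hW) (hi W' hW')
  have heq : ∫ ω, (W ω - W' ω) * (F (W ω) - F (W' ω)) ∂μ
      = ∫ ω, (F (W ω) * (W ω - W' ω) - F (W' ω) * (W ω - W' ω)) ∂μ :=
    integral_congr_ae (Filter.Eventually.of_forall fun ω => by ring)
  rw [heq, hsub]
  linarith

/-- The exchangeable-pair identity for Lipschitz functions of at most linear growth. The product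
`F (W) * (W - W')` need not be integrable, so the identity is obtained by truncating `F`. -/
theorem integral_mul_drift_of_exchangeable [IsFiniteMeasure μ] (hW : Measurable W) (hW' : Measurable W')
    (hWint : Integrable W μ) (hW'int : Integrable W' μ)
    (hexch : μ.map (fun ω => (W ω, W' ω)) = μ.map (fun ω => (W' ω, W ω)))
    {c : ℝ} {r : ℝ → ℝ}
    (hcond : μ[fun ω => W ω - W' ω | MeasurableSpace.comap W (borel ℝ)]
      =ᵐ[μ] fun ω => c + r (W ω))
    (hΔ2 : Integrable (fun ω => (W ω - W' ω) ^ 2) μ)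
    (hrInt : Integrable (fun ω => W ω * r (W ω)) μ)
    {F : ℝ → ℝ} {B : ℝ} (hB : 0 ≤ B) (hF0 : ∀ x, |F x| ≤ B * |x|)
    (hFL : ∀ x y, |F y - F x| ≤ B * |y - x|) :
    2 * ∫ ω, F (W ω) * (c + r (W ω)) ∂μ = ∫ ω, (W ω - W' ω) * (F (W ω) - F (W' ω)) ∂μ := by
  have hF : Measurable F := (continuous_of_abs_sub_le hB hFL).measurable
  have hm : MeasurableSpace.comap W (borel ℝ) ≤ ‹MeasurableSpace Ω› := hW.comap_le
  set T : ℕ → ℝ → ℝ := fun n x => max (-(n : ℝ)) (min (n : ℝ) (F x)) with hT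
  have hTm : ∀ n, Measurable (T n) := fun n => by fun_prop
  have hTn : ∀ n x, |T n x| ≤ n := fun n x => by
    have : (0 : ℝ) ≤ n := n.cast_nonneg
    exact abs_le.2 ⟨le_max_left _ _, max_le (by linarith) (min_le_left _ _)⟩
  have hTF : ∀ n x, |T n x| ≤ |F x| := fun n x => by
    have h0 : (0 : ℝ) ≤ n := n.cast_nonneg
    refine abs_le.2 ⟨le_max_of_le_right (le_min ?_ (neg_abs_le _)), max_le ?_ ?_⟩
    · linarith [abs_nonneg (F x)]
    · linarith [abs_nonneg (F x)]
    · exact (min_le_right _ _).trans (le_abs_self _)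
  have hTL : ∀ n x y, |T n y - T n x| ≤ |F y - F x| := fun n x y => by
    calc |T n y - T n x| ≤ |min (n : ℝ) (F y) - min (n : ℝ) (F x)| := by
          simp only [hT, max_comm (-(n : ℝ))]
          exact abs_max_sub_max_le_abs _ _ _
      _ ≤ |F y - F x| := by
          have := abs_min_sub_min_le_max (n : ℝ) (F y) n (F x)
          simpa using this
  have hTlim : ∀ x, Filter.Tendsto (fun n => T n x) Filter.atTop (nhds (F x)) := fun x => by
    refine tendsto_const_nhds.congr' ?_
    filter_upwards [Filter.eventually_ge_atTop ⌈|F x|⌉₊] with n hn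
    obtain ⟨h1, h2⟩ := abs_le.1 ((Nat.le_ceil _).trans (Nat.cast_le.2 hn) : |F x| ≤ n)
    simp only [hT]
    rw [min_eq_right h2, max_eq_right h1]
  have hdrift : AEStronglyMeasurable (fun ω => c + r (W ω)) μ :=
    (integrable_condExp.aestronglyMeasurable).congr hcond
  have hn : ∀ n : ℕ, 2 * ∫ ω, T n (W ω) * (c + r (W ω)) ∂μ
      = ∫ ω, (W ω - W' ω) * (T n (W ω) - T n (W' ω)) ∂μ := fun n => by
    rw [← two_mul_integral_sub_mul_of_exchangeable hW hW' hWint hW'int hexch (hTm n) (hTn n),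
      ← integral_mul_condExp_of_bounded (f := fun ω => T n (W ω))
        (g := fun ω => W ω - W' ω) hm
        ((hTm n).comp (comap_measurable W)).stronglyMeasurable (fun ω => hTn n (W ω))
        (hWint.sub hW'int)]
    congr 1
    refine integral_congr_ae ?_
    filter_upwards [hcond] with ω hω
    exact congrArg _ hω.symm
  have hlim1 : Filter.Tendsto (fun n : ℕ => ∫ ω, T n (W ω) * (c + r (W ω)) ∂μ) Filter.atTop
      (nhds (∫ ω, F (W ω) * (c + r (W ω)) ∂μ)) := by
    refine tendsto_integral_of_dominated_convergence
      (fun ω => B * (|c| * |W ω| + |W ω * r (W ω)|))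
      (fun n => ((hTm n).comp hW).aestronglyMeasurable.mul hdrift)
      (((hWint.abs.const_mul _).add hrInt.abs).const_mul _)
      (fun n => Filter.Eventually.of_forall fun ω => ?_)
      (Filter.Eventually.of_forall fun ω => (hTlim _).mul_const _)
    rw [Real.norm_eq_abs, abs_mul, abs_mul]
    calc |T n (W ω)| * |c + r (W ω)| ≤ (B * |W ω|) * (|c| + |r (W ω)|) :=
          mul_le_mul ((hTF n _).trans (hF0 _)) (abs_add_le _ _) (abs_nonneg _) (by positivity)
      _ = B * (|c| * |W ω| + |W ω| * |r (W ω)|) := by ring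
  have hlim2 : Filter.Tendsto (fun n : ℕ => ∫ ω, (W ω - W' ω) * (T n (W ω) - T n (W' ω)) ∂μ)
      Filter.atTop (nhds (∫ ω, (W ω - W' ω) * (F (W ω) - F (W' ω)) ∂μ)) := by
    refine tendsto_integral_of_dominated_convergence (fun ω => B * (W ω - W' ω) ^ 2)
      (fun n => ((hW.sub hW').mul
        (((hTm n).comp hW).sub ((hTm n).comp hW'))).aestronglyMeasurable)
      (hΔ2.const_mul _) (fun n => Filter.Eventually.of_forall fun ω => ?_)
      (Filter.Eventually.of_forall fun ω => ((hTlim _).sub (hTlim _)).const_mul _)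
    rw [Real.norm_eq_abs, abs_mul, ← sq_abs]
    nlinarith [(hTL n (W' ω) (W ω)).trans (hFL _ _), abs_nonneg (W ω - W' ω)]
  exact tendsto_nhds_unique (hlim1.const_mul 2) (hlim2.congr fun n => (hn n).symm)

end ExchangeablePair

/-- **Theorem 3.1(i)** (Chatterjee–Shao). Exponential approximation for exchangeable pairs
with E(W - W'|W) = 1/c₀ + r(W): bound for absolutely continuous test functions. -/
theorem exchangeable_pair_exponential_approx_smooth
    {Ω : Type*} [MeasurableSpace Ω] {μ : Measure Ω} [IsProbabilityMeasure μ]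
    (W W' Y : Ω → ℝ) (hWmeas : Measurable W) (hW'meas : Measurable W')
    (hYmeas : Measurable Y)
    (hWint : Integrable W μ) (hW'int : Integrable W' μ)
    -- (W, W') is an exchangeable pair
    (hexch : μ.map (fun ω => (W ω, W' ω)) = μ.map (fun ω => (W' ω, W ω)))
    -- E(W - W' | W) = 1/c₀ + r(W)
    (c₀ : ℝ) (hc₀ : 0 < c₀) (r : ℝ → ℝ)
    (hcond : μ[fun ω => W ω - W' ω | MeasurableSpace.comap W (borel ℝ)]
      =ᵐ[μ] fun ω => 1 / c₀ + r (W ω))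
    -- Y is exponential with mean 1, i.e. has density e^{-x} on (0, ∞)
    (hYdens : μ.map Y
      = volume.withDensity
          (fun x => ENNReal.ofReal (if 0 < x then Real.exp (-x) else 0)))
    -- moment assumptions: E|Δ|³ < ∞ and E|W·r(W)| < ∞
    (hΔ3 : Integrable (fun ω => |W ω - W' ω| ^ 3) μ)
    (hrInt : Integrable (fun ω => W ω * r (W ω)) μ)
    -- h absolutely continuous with ‖h'‖ = sup |h'| ≤ B < ∞
    (h h' : ℝ → ℝ) (B : ℝ)
    (hhAC : ∀ x y : ℝ, h y - h x = ∫ t in x..y, h' t)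
    (hh'B : ∀ x, |h' x| ≤ B) :
    |(∫ ω, h (W ω) ∂μ) - ∫ ω, h (Y ω) ∂μ|
      ≤ B * ((∫ ω, |1 - c₀ / 2
              * (μ[fun ω' => (W ω' - W' ω') ^ 2
                  | MeasurableSpace.comap W (borel ℝ)]) ω| ∂μ)
          + c₀ * ∫ ω, |W ω - W' ω| ^ 3 ∂μ
          + 3 * c₀ * ∫ ω, |W ω * r (W ω)| ∂μ) := by
  have hB : 0 ≤ B := (abs_nonneg _).trans (hh'B 0)
  have hL : ∀ x y, |h y - h x| ≤ B * |y - x| := fun x y => by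
    rw [hhAC]
    rw [← Real.norm_eq_abs]
    exact intervalIntegral.norm_integral_le_of_norm_le_const fun t _ => hh'B t
  have hm : MeasurableSpace.comap W (borel ℝ) ≤ ‹MeasurableSpace Ω› := hWmeas.comap_le
  rw [integral_comp_of_map_eq_exponential hYmeas hYdens
    (continuous_of_abs_sub_le hB hL).measurable]
  obtain ⟨f, f', hf, hstein, hf0, hfL, hf'B, hf'L⟩ := exists_exponential_stein_solution hB hL
  have hfm : Measurable f := (continuous_of_abs_sub_le hB hfL).measurable
  have hf'm : Measurable f' := (continuous_of_abs_sub_le (by positivity) hf'L).measurable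
  have hf'W : Integrable (fun ω => f' (W ω)) μ :=
    Integrable.of_bound (hf'm.comp hWmeas).aestronglyMeasurable B
      (Filter.Eventually.of_forall fun ω => hf'B _)
  have hfW : Integrable (fun ω => f (W ω)) μ :=
    (hWint.abs.const_mul B).mono' (hfm.comp hWmeas).aestronglyMeasurable
      (Filter.Eventually.of_forall fun ω => hf0 _)
  have hΔ2 : Integrable (fun ω => (W ω - W' ω) ^ 2) μ := by
    refine ((integrable_const (1 : ℝ)).add hΔ3).mono' (by fun_prop)
      (Filter.Eventually.of_forall fun ω => ?_)
    rw [Real.norm_eq_abs, abs_of_nonneg (sq_nonneg _), ← sq_abs]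
    simp only [Pi.add_apply]
    have ha := abs_nonneg (W ω - W' ω)
    rcases le_total (|W ω - W' ω|) 1 with h1 | h1
    · nlinarith [pow_nonneg ha 3]
    · nlinarith [pow_nonneg ha 2]
  set E2 : Ω → ℝ := μ[fun ω' => (W ω' - W' ω') ^ 2 | MeasurableSpace.comap W (borel ℝ)]
  have hE2int : Integrable E2 μ := integrable_condExp
  have hrm : AEStronglyMeasurable (fun ω => r (W ω)) μ := by
    have h1 : AEStronglyMeasurable (fun ω => 1 / c₀ + r (W ω)) μ :=
      (integrable_condExp.aestronglyMeasurable).congr hcond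
    exact (h1.sub (aestronglyMeasurable_const (b := 1 / c₀))).congr
      (Filter.Eventually.of_forall fun ω => add_sub_cancel_left _ _)
  have hfr_le : ∀ ω, |f (W ω) * r (W ω)| ≤ B * |W ω * r (W ω)| := fun ω => by
    rw [abs_mul, abs_mul, ← mul_assoc]
    exact mul_le_mul_of_nonneg_right (hf0 _) (abs_nonneg _)
  have hfr : Integrable (fun ω => f (W ω) * r (W ω)) μ :=
    (hrInt.abs.const_mul B).mono' ((hfm.comp hWmeas).aestronglyMeasurable.mul hrm)
      (Filter.Eventually.of_forall hfr_le)
  have hf'Δ2 : Integrable (fun ω => f' (W ω) * (W ω - W' ω) ^ 2) μ :=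
    hΔ2.bdd_mul (hf'm.comp hWmeas).aestronglyMeasurable
      (Filter.Eventually.of_forall fun ω => hf'B _)
  have hf'E2 : Integrable (fun ω => f' (W ω) * E2 ω) μ :=
    hE2int.bdd_mul (hf'm.comp hWmeas).aestronglyMeasurable
      (Filter.Eventually.of_forall fun ω => hf'B _)
  have hcondΔ2 : ∫ ω, f' (W ω) * E2 ω ∂μ = ∫ ω, f' (W ω) * (W ω - W' ω) ^ 2 ∂μ :=
    integral_mul_condExp_of_bounded hm
      (hf'm.comp (comap_measurable W)).stronglyMeasurable (fun ω => hf'B _) hΔ2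
  set R : Ω → ℝ := fun ω =>
    (W ω - W' ω) * (f (W ω) - f (W' ω)) - f' (W ω) * (W ω - W' ω) ^ 2 with hR
  have hR_le : ∀ ω, |R ω| ≤ 2 * B * |W ω - W' ω| ^ 3 := fun ω => by
    have h1 : R ω
        = (W ω - W' ω) * (f (W ω) - f (W' ω) - f' (W ω) * (W ω - W' ω)) := by
      simp only [hR]; ring
    rw [h1, abs_mul]
    calc _ ≤ |W ω - W' ω| * (2 * B * |W ω - W' ω| * |W ω - W' ω|) :=
          mul_le_mul_of_nonneg_left
            (abs_sub_sub_deriv_mul_le (by positivity) hf hf'L _ _) (abs_nonneg _)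
      _ = _ := by ring
  have hRint : Integrable R μ :=
    (hΔ3.const_mul (2 * B)).mono' (by fun_prop) (Filter.Eventually.of_forall hR_le)
  have hpair := integral_mul_drift_of_exchangeable hWmeas hW'meas hWint hW'int hexch hcond hΔ2
    hrInt hB hf0 hfL
  have hleft : ∫ ω, f (W ω) * (1 / c₀ + r (W ω)) ∂μ
      = 1 / c₀ * ∫ ω, f (W ω) ∂μ + ∫ ω, f (W ω) * r (W ω) ∂μ := by
    rw [← integral_const_mul, ← integral_add (hfW.const_mul _) hfr]
    exact integral_congr_ae (Filter.Eventually.of_forall fun ω => by ring)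
  have hright : ∫ ω, (W ω - W' ω) * (f (W ω) - f (W' ω)) ∂μ
      = ∫ ω, f' (W ω) * E2 ω ∂μ + ∫ ω, R ω ∂μ := by
    rw [hcondΔ2, ← integral_add hf'Δ2 hRint]
    exact integral_congr_ae (Filter.Eventually.of_forall fun ω => by simp only [hR]; ring)
  rw [hleft, hright] at hpair
  have hh : ∫ ω, h (W ω) ∂μ - ∫ x in Set.Ioi (0 : ℝ), h x * Real.exp (-x)
      = ∫ ω, f' (W ω) ∂μ - ∫ ω, f (W ω) ∂μ := by
    have h1 : ∫ ω, h (W ω) ∂μ = ∫ ω, ((f' (W ω) - f (W ω))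
        + ∫ x in Set.Ioi (0 : ℝ), h x * Real.exp (-x)) ∂μ :=
      integral_congr_ae (Filter.Eventually.of_forall fun ω => by
        simp only [hstein]; ring)
    have hsub : Integrable (fun ω => f' (W ω) - f (W ω)) μ := hf'W.sub hfW
    rw [h1, integral_add hsub (integrable_const _), integral_sub hf'W hfW]
    simp
  have hmain : ∫ ω, f' (W ω) * (1 - c₀ / 2 * E2 ω) ∂μ
      = ∫ ω, f' (W ω) ∂μ - c₀ / 2 * ∫ ω, f' (W ω) * E2 ω ∂μ := by
    rw [← integral_const_mul, ← integral_sub hf'W (hf'E2.const_mul _)]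
    exact integral_congr_ae (Filter.Eventually.of_forall fun ω => by ring)
  have hfval : ∫ ω, f (W ω) ∂μ = c₀ / 2 * ∫ ω, f' (W ω) * E2 ω ∂μ
      + c₀ / 2 * ∫ ω, R ω ∂μ - c₀ * ∫ ω, f (W ω) * r (W ω) ∂μ := by
    field_simp at hpair
    linarith
  have hdecomp : ∫ ω, h (W ω) ∂μ - ∫ x in Set.Ioi (0 : ℝ), h x * Real.exp (-x)
      = ∫ ω, f' (W ω) * (1 - c₀ / 2 * E2 ω) ∂μ - c₀ / 2 * ∫ ω, R ω ∂μ
        + c₀ * ∫ ω, f (W ω) * r (W ω) ∂μ := by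
    rw [hh, hmain, hfval]; ring
  have b1 : |∫ ω, f' (W ω) * (1 - c₀ / 2 * E2 ω) ∂μ| ≤ B * ∫ ω, |1 - c₀ / 2 * E2 ω| ∂μ := by
    have hint : Integrable (fun ω => 1 - c₀ / 2 * E2 ω) μ :=
      (integrable_const 1).sub (hE2int.const_mul _)
    rw [← integral_const_mul, ← Real.norm_eq_abs]
    refine norm_integral_le_of_norm_le (hint.abs.const_mul B)
      (Filter.Eventually.of_forall fun ω => ?_)
    rw [Real.norm_eq_abs, abs_mul]
    exact mul_le_mul_of_nonneg_right (hf'B _) (abs_nonneg _)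
  have b2 : |∫ ω, R ω ∂μ| ≤ 2 * B * ∫ ω, |W ω - W' ω| ^ 3 ∂μ := by
    rw [← integral_const_mul, ← Real.norm_eq_abs]
    exact norm_integral_le_of_norm_le (hΔ3.const_mul _) (Filter.Eventually.of_forall hR_le)
  have b3 : |∫ ω, f (W ω) * r (W ω) ∂μ| ≤ B * ∫ ω, |W ω * r (W ω)| ∂μ := by
    rw [← integral_const_mul, ← Real.norm_eq_abs]
    exact norm_integral_le_of_norm_le (hrInt.abs.const_mul _) (Filter.Eventually.of_forall hfr_le)
  have hnonneg : 0 ≤ c₀ * (B * ∫ ω, |W ω * r (W ω)| ∂μ) := by positivity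
  have t2 := mul_le_mul_of_nonneg_left b2 (half_pos hc₀).le
  have t3 := mul_le_mul_of_nonneg_left b3 hc₀.le
  rw [hdecomp]
  calc _ ≤ |∫ ω, f' (W ω) * (1 - c₀ / 2 * E2 ω) ∂μ| + |c₀ / 2 * ∫ ω, R ω ∂μ|
        + |c₀ * ∫ ω, f (W ω) * r (W ω) ∂μ| :=
        (abs_add_le _ _).trans (add_le_add_left (abs_sub _ _) _)
    _ ≤ _ := by
        rw [abs_mul (c₀ / 2), abs_mul c₀, abs_of_pos hc₀, abs_of_pos (half_pos hc₀)]
        linarith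
end

section
/- Let (W,W') be an exchangeable pair with E(W−W'|W) = 1/c₀ + r(W), where c₀ > 0 is a constant, set Δ = W − W', and assume |Δ| ≤ δ for some constant δ. Let Y be exponentially distributed with mean 1. Then for every z ∈ ℝ, |P(W ≤ z) − P(Y ≤ z)| ≤ 3·E|1 − (c₀/2)E(Δ²|W)| + δ + 2·c₀·δ³ + 3·c₀·E|W·r(W)|. -/
open MeasureTheory

/-- A bounded function of `W` can be pulled inside a conditional expectation given `W`. -/
lemma integral_mul_condExp_comap {Ω : Type*} [MeasurableSpace Ω] {μ : Measure Ω}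
    [IsProbabilityMeasure μ] {W X : Ω → ℝ} (hW : Measurable W) (hX : Integrable X μ)
    {g : ℝ → ℝ} (hg : Measurable g) {C : ℝ} (hC : ∀ x, |g x| ≤ C) :
    ∫ ω, g (W ω) * (μ[X | MeasurableSpace.comap W (borel ℝ)]) ω ∂μ = ∫ ω, g (W ω) * X ω ∂μ := by
  have hborel : borel ℝ = (inferInstance : MeasurableSpace ℝ) := BorelSpace.measurable_eq.symm
  have hle : MeasurableSpace.comap W (borel ℝ) ≤ (inferInstance : MeasurableSpace Ω) := by
    rw [hborel]; exact hW.comap_le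
  have hgW : StronglyMeasurable[MeasurableSpace.comap W (borel ℝ)] (fun ω => g (W ω)) := by
    rw [hborel]; exact (hg.comp (comap_measurable W)).stronglyMeasurable
  have hint : Integrable ((fun ω => g (W ω)) * X) μ :=
    hX.bdd_mul (c := C) (hg.comp hW).aestronglyMeasurable
      (Filter.Eventually.of_forall fun ω => hC (W ω))
  rw [← integral_condExp hle (f := fun ω => g (W ω) * X ω)]
  exact integral_congr_ae (condExp_mul_of_stronglyMeasurable_left hgW hint hX).symm

/-- Integrals of functions of an exchangeable pair are invariant under swapping the pair. -/
lemma integral_swap_of_exchangeable {Ω : Type*} [MeasurableSpace Ω] {μ : Measure Ω}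
    {W W' : Ω → ℝ} (hW : Measurable W) (hW' : Measurable W')
    (hexch : μ.map (fun ω => (W ω, W' ω)) = μ.map (fun ω => (W' ω, W ω)))
    {F : ℝ × ℝ → ℝ} (hF : Measurable F) :
    ∫ ω, F (W ω, W' ω) ∂μ = ∫ ω, F (W' ω, W ω) ∂μ := by
  rw [← integral_map (φ := fun ω => (W ω, W' ω)) (hW.prodMk hW').aemeasurable
    hF.aestronglyMeasurable, hexch,
    integral_map (hW'.prodMk hW).aemeasurable hF.aestronglyMeasurable]

/-- The distribution function of a variable with density `e^{-x}` on `(0, ∞)`. -/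
lemma measure_le_of_map_eq_exp {Ω : Type*} [MeasurableSpace Ω] {μ : Measure Ω}
    {Y : Ω → ℝ} (hY : Measurable Y)
    (hYdens : μ.map Y
      = volume.withDensity
          (fun x => ENNReal.ofReal (if 0 < x then Real.exp (-x) else 0))) (z : ℝ) :
    (μ {ω | Y ω ≤ z}).toReal = if 0 ≤ z then 1 - Real.exp (-z) else 0 := by
  have hmap : μ.map Y = ProbabilityTheory.expMeasure 1 := by
    rw [hYdens, show ProbabilityTheory.expMeasure 1
      = volume.withDensity (ProbabilityTheory.exponentialPDF 1) from rfl]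
    refine withDensity_congr_ae ?_
    filter_upwards [compl_mem_ae_iff.2 (measure_singleton (0 : ℝ))] with x hx
    have hx0 : x ≠ 0 := hx
    rw [ProbabilityTheory.exponentialPDF_eq]
    rcases lt_or_gt_of_ne hx0 with h | h
    · simp [h.not_gt, h.not_ge]
    · simp [h, h.le]
  have := ProbabilityTheory.isProbabilityMeasure_expMeasure one_pos
  have hcdf := ProbabilityTheory.cdf_expMeasure_eq one_pos z
  rw [ProbabilityTheory.cdf_eq_real, ← hmap, measureReal_def,
    Measure.map_apply hY measurableSet_Iic, one_mul] at hcdf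
  exact hcdf

/-- The derivative, continuous from the left, of the Stein solution `steinExp z`. -/
noncomputable def steinExpDeriv (z w : ℝ) : ℝ := if w ≤ z then Real.exp (w - z) else 0

/-- The solution of the exponential Stein equation for the indicator of `(-∞, z]`. -/
noncomputable def steinExp (z w : ℝ) : ℝ := Real.exp (min w z - z) - Real.exp (-z)

/-- The identity truncated to `[z - δ, z + δ]` and shifted to vanish at the origin. -/
noncomputable def truncShift (z δ w : ℝ) : ℝ :=
  max (z - δ) (min w (z + δ)) - max (z - δ) (min 0 (z + δ))

lemma measurable_steinExpDeriv (z : ℝ) : Measurable (steinExpDeriv z) :=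
  Measurable.ite measurableSet_Iic (by fun_prop) measurable_const

lemma measurable_steinExp (z : ℝ) : Measurable (steinExp z) := by
  unfold steinExp; fun_prop

lemma measurable_truncShift (z δ : ℝ) : Measurable (truncShift z δ) := by
  unfold truncShift; fun_prop

lemma abs_steinExpDeriv_le_one (z w : ℝ) : |steinExpDeriv z w| ≤ 1 := by
  unfold steinExpDeriv
  split_ifs with h
  · rw [abs_of_pos (Real.exp_pos _)]
    exact Real.exp_le_one_iff.2 (by linarith)
  · simp

lemma steinExp_equation (z w : ℝ) :
    steinExpDeriv z w - steinExp z w = (if w ≤ z then 1 else 0) - (1 - Real.exp (-z)) := by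
  unfold steinExpDeriv steinExp
  split_ifs with h
  · rw [min_eq_left h]; ring
  · rw [min_eq_right (not_le.1 h).le]; simp

/-- Secants of the exponential lie between its tangents at the two ends. -/
lemma exp_sub_exp_bounds (a b : ℝ) :
    (b - a) * Real.exp a ≤ Real.exp b - Real.exp a ∧
      Real.exp b - Real.exp a ≤ (b - a) * Real.exp b := by
  have h1 := Real.add_one_le_exp (b - a)
  have h2 := Real.add_one_le_exp (a - b)
  have e1 : Real.exp b = Real.exp (b - a) * Real.exp a := by rw [← Real.exp_add]; ring_nf
  have e2 : Real.exp a = Real.exp (a - b) * Real.exp b := by rw [← Real.exp_add]; ring_nf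
  constructor
  · nlinarith [Real.exp_pos a]
  · nlinarith [Real.exp_pos b]

lemma abs_steinExp_le_one {z : ℝ} (hz : 0 ≤ z) (w : ℝ) : |steinExp z w| ≤ 1 := by
  unfold steinExp
  have h1 : Real.exp (min w z - z) ≤ 1 := Real.exp_le_one_iff.2 (by linarith [min_le_right w z])
  have h2 : Real.exp (-z) ≤ 1 := Real.exp_le_one_iff.2 (by linarith)
  rw [abs_le]
  constructor <;> linarith [Real.exp_pos (min w z - z), Real.exp_pos (-z)]

lemma abs_steinExp_le_abs {z : ℝ} (hz : 0 ≤ z) (w : ℝ) : |steinExp z w| ≤ |w| := by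
  unfold steinExp
  have h1 : Real.exp (min w z - z) ≤ 1 := Real.exp_le_one_iff.2 (by linarith [min_le_right w z])
  have h2 : Real.exp (-z) ≤ 1 := Real.exp_le_one_iff.2 (by linarith)
  rcases le_total w 0 with hw | hw
  · have hm : min w z = w := min_eq_left (hw.trans hz)
    rw [hm] at h1 ⊢
    have hb := (exp_sub_exp_bounds (w - z) (-z)).2
    rw [abs_of_nonpos hw, abs_le]
    constructor
    · nlinarith
    · linarith [Real.exp_le_exp.2 (show w - z ≤ -z by linarith)]
  · have hm : 0 ≤ min w z := le_min hw hz
    have hb := (exp_sub_exp_bounds (-z) (min w z - z)).2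
    rw [abs_of_nonneg hw, abs_le]
    constructor
    · linarith [Real.exp_le_exp.2 (show -z ≤ min w z - z by linarith)]
    · nlinarith [min_le_left w z]

lemma truncShift_le {z δ : ℝ} (hδ : 0 ≤ δ) (w : ℝ) : truncShift z δ w ≤ 2 * δ := by
  unfold truncShift
  have h1 : max (z - δ) (min w (z + δ)) ≤ z + δ := max_le (by linarith) (min_le_right _ _)
  linarith [le_max_left (z - δ) (min 0 (z + δ))]

lemma neg_le_truncShift {z δ : ℝ} (hδ : 0 ≤ δ) (w : ℝ) : -(2 * δ) ≤ truncShift z δ w := by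
  unfold truncShift
  have h1 : max (z - δ) (min 0 (z + δ)) ≤ z + δ := max_le (by linarith) (min_le_right _ _)
  linarith [le_max_left (z - δ) (min w (z + δ))]

lemma abs_truncShift_le_abs (z δ w : ℝ) : |truncShift z δ w| ≤ |w| := by
  unfold truncShift
  have h1 := abs_max_sub_max_le_abs (min w (z + δ)) (min 0 (z + δ)) (z - δ)
  have h2 := abs_min_sub_min_le_max w (z + δ) 0 (z + δ)
  rw [max_comm (min w (z + δ)), max_comm (min 0 (z + δ))] at h1
  refine h1.trans (h2.trans ?_)
  simp

/-- The trapezoidal error for the increment of `steinExp` over an ordered pair. -/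
lemma abs_trapezoid_steinExp_sub_le_of_le {z δ a b : ℝ} (hab : a ≤ b) (hδ : b - a ≤ δ) :
    |(b - a) ^ 2 * ((steinExpDeriv z a + steinExpDeriv z b) / 2)
        - (b - a) * (steinExp z b - steinExp z a)|
      ≤ (b - a) * (truncShift z δ b - truncShift z δ a) / 2 + δ ^ 3 / 2 := by
  have hd : 0 ≤ b - a := sub_nonneg.2 hab
  have hδ0 : 0 ≤ δ := hd.trans hδ
  have hcube : (b - a) ^ 3 ≤ δ ^ 3 := by gcongr
  have hmono : truncShift z δ a ≤ truncShift z δ b := by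
    unfold truncShift; gcongr
  have hk : 0 ≤ (b - a) * (truncShift z δ b - truncShift z δ a) :=
    mul_nonneg hd (sub_nonneg.2 hmono)
  have hδ3 : 0 ≤ δ ^ 3 := by positivity
  rcases le_or_gt b z with hbz | hbz
  · have haz : a ≤ z := hab.trans hbz
    obtain ⟨h1, h2⟩ := exp_sub_exp_bounds (a - z) (b - z)
    rw [show b - z - (a - z) = b - a by ring] at h1 h2
    have h3 : Real.exp (b - z) ≤ 1 := Real.exp_le_one_iff.2 (by linarith)
    have h4 : Real.exp (b - z) - Real.exp (a - z) ≤ b - a := by nlinarith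
    simp only [steinExpDeriv, steinExp, if_pos hbz, if_pos haz, min_eq_left hbz, min_eq_left haz]
    have h5 := mul_le_mul_of_nonneg_left h1 hd
    have h6 := mul_le_mul_of_nonneg_left h2 hd
    have h7 := mul_le_mul_of_nonneg_left h4 (sq_nonneg (b - a))
    rw [abs_le]
    constructor <;> nlinarith
  · rcases le_or_gt a z with haz | haz
    · have hka : truncShift z δ b - truncShift z δ a = b - a := by
        unfold truncShift
        rw [min_eq_left (by linarith : b ≤ z + δ), min_eq_left (by linarith : a ≤ z + δ),
          max_eq_right (by linarith : z - δ ≤ b), max_eq_right (by linarith : z - δ ≤ a)]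
        ring
      rw [hka]
      simp only [steinExpDeriv, steinExp, if_neg hbz.not_ge, if_pos haz, min_eq_right hbz.le,
        min_eq_left haz, sub_self, Real.exp_zero]
      have h1 : Real.exp (a - z) ≤ 1 := Real.exp_le_one_iff.2 (by linarith)
      have h2 := Real.add_one_le_exp (a - z)
      have h3 : 1 - Real.exp (a - z) ≤ b - a := by linarith
      have h4 := mul_le_mul_of_nonneg_left h3 hd
      have h5 := mul_le_mul_of_nonneg_left h3 (sq_nonneg (b - a))
      have h6 := mul_le_mul_of_nonneg_left h1 (sq_nonneg (b - a))
      have h7 := mul_nonneg hd (sub_nonneg.2 h1)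
      rw [abs_le]
      constructor <;> nlinarith
    · simp only [steinExpDeriv, steinExp, if_neg hbz.not_ge, if_neg haz.not_ge,
        min_eq_right hbz.le, min_eq_right haz.le]
      simp only [add_zero, zero_div, mul_zero, sub_self, abs_zero]
      linarith

lemma abs_trapezoid_steinExp_sub_le {z δ a b : ℝ} (hδ : |a - b| ≤ δ) :
    |(a - b) ^ 2 * ((steinExpDeriv z a + steinExpDeriv z b) / 2)
        - (a - b) * (steinExp z a - steinExp z b)|
      ≤ (a - b) * (truncShift z δ a - truncShift z δ b) / 2 + δ ^ 3 / 2 := by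
  rcases le_total a b with h | h
  · have := abs_trapezoid_steinExp_sub_le_of_le (z := z) h
      (show b - a ≤ δ by linarith [neg_abs_le (a - b)])
    convert this using 2 <;> ring
  · have := abs_trapezoid_steinExp_sub_le_of_le (z := z) h ((le_abs_self _).trans hδ)
    convert this using 2
    ring

/-- The exchangeable pair identity
`E[(W - W') (g W - g W')] = 2 E[g W / c₀] + 2 E[g W * r W]`. -/
lemma integral_exchangeable_increment {Ω : Type*} [MeasurableSpace Ω] {μ : Measure Ω}
    [IsProbabilityMeasure μ] {W W' : Ω → ℝ} (hW : Measurable W) (hW' : Measurable W')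
    (hWint : Integrable W μ) (hW'int : Integrable W' μ)
    (hexch : μ.map (fun ω => (W ω, W' ω)) = μ.map (fun ω => (W' ω, W ω)))
    {c₀ : ℝ} {r : ℝ → ℝ}
    (hcond : μ[fun ω => W ω - W' ω | MeasurableSpace.comap W (borel ℝ)]
      =ᵐ[μ] fun ω => 1 / c₀ + r (W ω))
    {g : ℝ → ℝ} (hg : Measurable g) {C : ℝ} (hC : ∀ x, |g x| ≤ C) :
    Integrable (fun ω => (W ω - W' ω) * (g (W ω) - g (W' ω))) μ ∧
    ∫ ω, (W ω - W' ω) * (g (W ω) - g (W' ω)) ∂μ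
      = 2 * ((∫ ω, g (W ω) ∂μ) / c₀ + ∫ ω, g (W ω) * r (W ω) ∂μ) := by
  have hΔ : Integrable (fun ω => W ω - W' ω) μ := hWint.sub hW'int
  have hb : ∀ V : Ω → ℝ, Measurable V → ∀ X : Ω → ℝ, Integrable X μ →
      Integrable (fun ω => g (V ω) * X ω) μ := fun V hV X hX =>
    hX.bdd_mul (c := C) (hg.comp hV).aestronglyMeasurable
      (Filter.Eventually.of_forall fun ω => hC (V ω))
  have hgW : Integrable (fun ω => g (W ω)) μ := by
    simpa using hb W hW (fun _ => 1) (integrable_const 1)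
  have hr : Integrable (fun ω => r (W ω)) μ := by
    refine ((integrable_condExp (μ := μ) (m := MeasurableSpace.comap W (borel ℝ))
      (f := fun ω => W ω - W' ω)).sub (integrable_const (1 / c₀))).congr ?_
    filter_upwards [hcond] with ω h
    simp [h]
  have hgr := hb W hW _ hr
  have h1 := hb W hW _ hΔ
  have h2 := hb W' hW' _ hΔ
  refine ⟨(h1.sub h2).congr (Filter.Eventually.of_forall fun ω => ?_), ?_⟩
  · simp only [Pi.sub_apply]; ring
  have hswap : ∫ ω, g (W' ω) * (W ω - W' ω) ∂μ = -∫ ω, g (W ω) * (W ω - W' ω) ∂μ := by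
    rw [integral_swap_of_exchangeable hW hW' hexch
      (F := fun p => g p.2 * (p.1 - p.2)) (by fun_prop), ← integral_neg]
    congr 1; ext ω; ring
  have hpull : ∫ ω, g (W ω) * (W ω - W' ω) ∂μ
      = (∫ ω, g (W ω) ∂μ) / c₀ + ∫ ω, g (W ω) * r (W ω) ∂μ := by
    rw [← integral_mul_condExp_comap hW hΔ hg hC, ← integral_div,
      ← integral_add (hgW.div_const c₀) hgr]
    refine integral_congr_ae ?_
    filter_upwards [hcond] with ω h
    rw [h]; ring
  calc ∫ ω, (W ω - W' ω) * (g (W ω) - g (W' ω)) ∂μ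
      = ∫ ω, (g (W ω) * (W ω - W' ω) - g (W' ω) * (W ω - W' ω)) ∂μ := by
        congr 1; ext ω; ring
    _ = 2 * ((∫ ω, g (W ω) ∂μ) / c₀ + ∫ ω, g (W ω) * r (W ω) ∂μ) := by
        rw [integral_sub h1 h2, hswap, hpull]; ring

/-- The Berry-Esseen bound at a nonnegative point, with better constants. -/
lemma abs_measure_le_sub_exp_cdf_le {Ω : Type*} [MeasurableSpace Ω] {μ : Measure Ω}
    [IsProbabilityMeasure μ] {W W' : Ω → ℝ} (hW : Measurable W) (hW' : Measurable W')
    (hWint : Integrable W μ) (hW'int : Integrable W' μ)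
    (hexch : μ.map (fun ω => (W ω, W' ω)) = μ.map (fun ω => (W' ω, W ω)))
    {c₀ : ℝ} (hc₀ : 0 < c₀) {r : ℝ → ℝ}
    (hcond : μ[fun ω => W ω - W' ω | MeasurableSpace.comap W (borel ℝ)]
      =ᵐ[μ] fun ω => 1 / c₀ + r (W ω))
    {δ : ℝ} (hδ0 : 0 ≤ δ) (hδ : ∀ ω, |W ω - W' ω| ≤ δ)
    (hrInt : Integrable (fun ω => W ω * r (W ω)) μ) {z : ℝ} (hz : 0 ≤ z) :
    |(μ {ω | W ω ≤ z}).toReal - (1 - Real.exp (-z))|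
      ≤ (∫ ω, |1 - c₀ / 2
              * (μ[fun ω' => (W ω' - W' ω') ^ 2
                  | MeasurableSpace.comap W (borel ℝ)]) ω| ∂μ)
        + δ + c₀ * δ ^ 3 / 4
        + 3 / 2 * c₀ * ∫ ω, |W ω * r (W ω)| ∂μ := by
  set V := μ[fun ω' => (W ω' - W' ω') ^ 2 | MeasurableSpace.comap W (borel ℝ)] with hV
  set φ := steinExpDeriv z
  set f := steinExp z
  set k := truncShift z δ
  set R := ∫ ω, |W ω * r (W ω)| ∂μ
  have hφ : Measurable φ := measurable_steinExpDeriv z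
  have hf : Measurable f := measurable_steinExp z
  have hk : Measurable k := measurable_truncShift z δ
  have hφ1 : ∀ x, |φ x| ≤ 1 := abs_steinExpDeriv_le_one z
  have hk2 : ∀ x, |k x| ≤ 2 * δ := fun x => abs_le.2 ⟨neg_le_truncShift hδ0 x, truncShift_le hδ0 x⟩
  have hbdd : ∀ V : Ω → ℝ, Measurable V → ∀ X : Ω → ℝ, Integrable X μ →
      Integrable (fun ω => φ (V ω) * X ω) μ := fun V hV X hX =>
    hX.bdd_mul (c := 1) (hφ.comp hV).aestronglyMeasurable
      (Filter.Eventually.of_forall fun ω => hφ1 (V ω))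
  have hsq : Integrable (fun ω => (W ω - W' ω) ^ 2) μ := by
    refine Integrable.of_bound (by fun_prop) (δ ^ 2) (Filter.Eventually.of_forall fun ω => ?_)
    rw [Real.norm_eq_abs, abs_pow]
    exact pow_le_pow_left₀ (abs_nonneg _) (hδ ω) 2
  have hVint : Integrable V μ := integrable_condExp
  have hφint : Integrable (fun ω => φ (W ω)) μ := by
    simpa using hbdd W hW (fun _ => 1) (integrable_const 1)
  have hfint : Integrable (fun ω => f (W ω)) μ :=
    Integrable.of_bound (hf.comp hW).aestronglyMeasurable 1
      (Filter.Eventually.of_forall fun ω => abs_steinExp_le_one hz (W ω))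
  obtain ⟨hfΔ, hfeq⟩ := integral_exchangeable_increment hW hW' hWint hW'int hexch hcond hf
    (abs_steinExp_le_one hz)
  obtain ⟨hkΔ, hkeq⟩ := integral_exchangeable_increment hW hW' hWint hW'int hexch hcond hk hk2
  have hremainder : ∀ g : ℝ → ℝ, (∀ x, |g x| ≤ |x|) → |∫ ω, g (W ω) * r (W ω) ∂μ| ≤ R := by
    intro g hg
    refine norm_integral_le_of_norm_le (f := fun ω => g (W ω) * r (W ω)) hrInt.abs
      (Filter.Eventually.of_forall fun ω => ?_)
    rw [Real.norm_eq_abs, abs_mul, abs_mul]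
    exact mul_le_mul_of_nonneg_right (hg _) (abs_nonneg _)
  have hRf := hremainder f (abs_steinExp_le_abs hz)
  have hRk := hremainder k (abs_truncShift_le_abs z δ)
  have hkmean : ∫ ω, k (W ω) ∂μ ≤ 2 * δ := by
    have hkint : Integrable (fun ω => k (W ω)) μ :=
      Integrable.of_bound (hk.comp hW).aestronglyMeasurable (2 * δ)
        (Filter.Eventually.of_forall fun ω => hk2 (W ω))
    simpa using integral_mono hkint (integrable_const (2 * δ)) fun ω => truncShift_le hδ0 (W ω)
  have hstein : (μ {ω | W ω ≤ z}).toReal - (1 - Real.exp (-z))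
      = ∫ ω, φ (W ω) ∂μ - ∫ ω, f (W ω) ∂μ := by
    have hset : MeasurableSet {ω | W ω ≤ z} := hW measurableSet_Iic
    have hind : ∫ ω, (if W ω ≤ z then (1 : ℝ) else 0) ∂μ = (μ {ω | W ω ≤ z}).toReal := by
      rw [← measureReal_def, ← integral_indicator_one hset]
      rfl
    have hindint : Integrable (fun ω => if W ω ≤ z then (1 : ℝ) else 0) μ :=
      (integrable_const (1 : ℝ)).indicator hset
    rw [← integral_sub hφint hfint]
    simp only [φ, f, steinExp_equation]
    rw [integral_sub hindint (integrable_const _), hind]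
    simp
  have hpull : ∫ ω, φ (W ω) * (1 - c₀ / 2 * V ω) ∂μ
      = ∫ ω, φ (W ω) ∂μ - c₀ / 2 * ∫ ω, φ (W ω) * (W ω - W' ω) ^ 2 ∂μ := by
    rw [← integral_mul_condExp_comap hW hsq hφ hφ1, ← hV, ← integral_const_mul,
      ← integral_sub hφint ((hbdd W hW V hVint).const_mul _)]
    congr 1; ext ω; ring
  have hA : |∫ ω, φ (W ω) * (1 - c₀ / 2 * V ω) ∂μ| ≤ ∫ ω, |1 - c₀ / 2 * V ω| ∂μ := by
    refine norm_integral_le_of_norm_le (f := fun ω => φ (W ω) * (1 - c₀ / 2 * V ω))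
      ((integrable_const 1).sub (hVint.const_mul _)).abs
      (Filter.Eventually.of_forall fun ω => ?_)
    rw [Real.norm_eq_abs, abs_mul]
    exact mul_le_of_le_one_left (abs_nonneg _) (hφ1 _)
  have hswap : ∫ ω, φ (W' ω) * (W ω - W' ω) ^ 2 ∂μ = ∫ ω, φ (W ω) * (W ω - W' ω) ^ 2 ∂μ := by
    rw [integral_swap_of_exchangeable hW hW' hexch
      (F := fun p => φ p.2 * (p.1 - p.2) ^ 2) (by fun_prop)]
    congr 1; ext ω; ring
  have hφW := hbdd W hW _ hsq
  have hφW' := hbdd W' hW' _ hsq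
  have htrap : |∫ ω, φ (W ω) * (W ω - W' ω) ^ 2 ∂μ
        - ∫ ω, (W ω - W' ω) * (f (W ω) - f (W' ω)) ∂μ|
      ≤ (∫ ω, (W ω - W' ω) * (k (W ω) - k (W' ω)) ∂μ) / 2 + δ ^ 3 / 2 := by
    have heq : ∫ ω, ((W ω - W' ω) ^ 2 * ((φ (W ω) + φ (W' ω)) / 2)
          - (W ω - W' ω) * (f (W ω) - f (W' ω))) ∂μ
        = ∫ ω, φ (W ω) * (W ω - W' ω) ^ 2 ∂μ
          - ∫ ω, (W ω - W' ω) * (f (W ω) - f (W' ω)) ∂μ := by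
      calc _ = ∫ ω, ((φ (W ω) * (W ω - W' ω) ^ 2 + φ (W' ω) * (W ω - W' ω) ^ 2) / 2
            - (W ω - W' ω) * (f (W ω) - f (W' ω))) ∂μ := by congr 1; ext ω; ring
        _ = _ := by
          rw [integral_sub (f := fun ω => (φ (W ω) * (W ω - W' ω) ^ 2
            + φ (W' ω) * (W ω - W' ω) ^ 2) / 2) ((hφW.add hφW').div_const 2) hfΔ, integral_div,
            integral_add hφW hφW', hswap]
          ring
    have heq' : ∫ ω, ((W ω - W' ω) * (k (W ω) - k (W' ω)) / 2 + δ ^ 3 / 2) ∂μ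
        = (∫ ω, (W ω - W' ω) * (k (W ω) - k (W' ω)) ∂μ) / 2 + δ ^ 3 / 2 := by
      rw [integral_add (hkΔ.div_const 2) (integrable_const _), integral_div]
      simp
    rw [← heq, ← heq']
    exact norm_integral_le_of_norm_le
      (g := fun ω => (W ω - W' ω) * (k (W ω) - k (W' ω)) / 2 + δ ^ 3 / 2)
      (f := fun ω => (W ω - W' ω) ^ 2 * ((φ (W ω) + φ (W' ω)) / 2)
        - (W ω - W' ω) * (f (W ω) - f (W' ω)))
      ((hkΔ.div_const 2).add (integrable_const _))
      (Filter.Eventually.of_forall fun ω => abs_trapezoid_steinExp_sub_le (hδ ω))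
  have hdecomp : (μ {ω | W ω ≤ z}).toReal - (1 - Real.exp (-z))
      = (∫ ω, φ (W ω) * (1 - c₀ / 2 * V ω) ∂μ)
        + c₀ / 2 * (∫ ω, φ (W ω) * (W ω - W' ω) ^ 2 ∂μ
          - ∫ ω, (W ω - W' ω) * (f (W ω) - f (W' ω)) ∂μ)
        + c₀ * ∫ ω, f (W ω) * r (W ω) ∂μ := by
    rw [hstein, hpull, hfeq]
    field_simp
    ring
  have hkbound : c₀ / 2 * ∫ ω, (W ω - W' ω) * (k (W ω) - k (W' ω)) ∂μ ≤ 2 * δ + c₀ * R := by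
    have : c₀ / 2 * ∫ ω, (W ω - W' ω) * (k (W ω) - k (W' ω)) ∂μ
        = ∫ ω, k (W ω) ∂μ + c₀ * ∫ ω, k (W ω) * r (W ω) ∂μ := by
      rw [hkeq]; field_simp
    rw [this]
    gcongr
    exact (le_abs_self _).trans hRk
  have htrap' := mul_le_mul_of_nonneg_left htrap (half_pos hc₀).le
  have hRf' := mul_le_mul_of_nonneg_left hRf hc₀.le
  rw [hdecomp]
  refine (abs_add_three _ _ _).trans ?_
  rw [abs_mul, abs_mul, abs_of_pos hc₀, abs_of_pos (half_pos hc₀)]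
  linarith

/-- **Theorem 3.1(ii)** (Chatterjee–Shao). Exponential approximation for exchangeable pairs
with E(W - W'|W) = 1/c₀ + r(W) and bounded increments: a Berry–Esseen type bound. -/
theorem exchangeable_pair_exponential_berry_esseen
    {Ω : Type*} [MeasurableSpace Ω] {μ : Measure Ω} [IsProbabilityMeasure μ]
    (W W' Y : Ω → ℝ) (hWmeas : Measurable W) (hW'meas : Measurable W')
    (hYmeas : Measurable Y)
    (hWint : Integrable W μ) (hW'int : Integrable W' μ)
    -- (W, W') is an exchangeable pair
    (hexch : μ.map (fun ω => (W ω, W' ω)) = μ.map (fun ω => (W' ω, W ω)))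
    -- E(W - W' | W) = 1/c₀ + r(W)
    (c₀ : ℝ) (hc₀ : 0 < c₀) (r : ℝ → ℝ)
    (hcond : μ[fun ω => W ω - W' ω | MeasurableSpace.comap W (borel ℝ)]
      =ᵐ[μ] fun ω => 1 / c₀ + r (W ω))
    -- |Δ| ≤ δ
    (δ : ℝ) (hδ : ∀ ω, |W ω - W' ω| ≤ δ)
    -- Y is exponential with mean 1, i.e. has density e^{-x} on (0, ∞)
    (hYdens : μ.map Y
      = volume.withDensity
          (fun x => ENNReal.ofReal (if 0 < x then Real.exp (-x) else 0)))
    -- moment assumption: E|W·r(W)| < ∞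
    (hrInt : Integrable (fun ω => W ω * r (W ω)) μ)
    (z : ℝ) :
    |(μ {ω | W ω ≤ z}).toReal - (μ {ω | Y ω ≤ z}).toReal|
      ≤ 3 * (∫ ω, |1 - c₀ / 2
              * (μ[fun ω' => (W ω' - W' ω') ^ 2
                  | MeasurableSpace.comap W (borel ℝ)]) ω| ∂μ)
        + δ + 2 * c₀ * δ ^ 3
        + 3 * c₀ * ∫ ω, |W ω * r (W ω)| ∂μ := by
  have hδ0 : 0 ≤ δ := by
    obtain ⟨ω⟩ := nonempty_of_isProbabilityMeasure μ
    exact (abs_nonneg _).trans (hδ ω)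
  have hA : 0 ≤ ∫ ω, |1 - c₀ / 2 * (μ[fun ω' => (W ω' - W' ω') ^ 2
      | MeasurableSpace.comap W (borel ℝ)]) ω| ∂μ := integral_nonneg fun ω => abs_nonneg _
  have hR : 0 ≤ c₀ * ∫ ω, |W ω * r (W ω)| ∂μ :=
    mul_nonneg hc₀.le (integral_nonneg fun ω => abs_nonneg _)
  have hδ3 : 0 ≤ c₀ * δ ^ 3 := by positivity
  rw [measure_le_of_map_eq_exp hYmeas hYdens]
  split_ifs with hz
  · have h := abs_measure_le_sub_exp_cdf_le hWmeas hW'meas hWint hW'int hexch hc₀ hcond hδ0 hδ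
      hrInt hz
    linarith
  · have h := abs_measure_le_sub_exp_cdf_le hWmeas hW'meas hWint hW'int hexch hc₀ hcond hδ0 hδ
      hrInt le_rfl
    have hmono : (μ {ω | W ω ≤ z}).toReal ≤ (μ {ω | W ω ≤ 0}).toReal :=
      ENNReal.toReal_mono (measure_ne_top _ _)
        (measure_mono fun ω (hω : W ω ≤ z) => hω.trans (not_le.1 hz).le)
    rw [neg_zero, Real.exp_zero, sub_self, sub_zero, abs_of_nonneg ENNReal.toReal_nonneg] at h
    rw [sub_zero, abs_of_nonneg ENNReal.toReal_nonneg]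
    linarith
end

section
/- Let n be a positive integer, let I be a random variable taking values in {0,1,…,n} with P(I = i) = π_i := (C(2n,i) − C(2n,i−1))/C(2n,n) (with C(2n,−1) := 0), and let W = (n−I)(n+1−I)/n. Let Y have the exponential distribution with mean 1. Then for every absolutely continuous function h: ℝ → ℝ with ‖h'‖ := sup_x |h'(x)| ≤ 1, one has |E h(W) − E h(Y)| ≤ 12·n^{−1/2}. -/
open MeasureTheory Finset

namespace BernoulliLaplace

/-- The upper tail of `n - I`, where `I` indexes the random eigenvalue. -/
noncomputable def tail (n j : ℕ) : ℝ :=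
  (Nat.choose (2 * n) (n + j) : ℝ) / (Nat.choose (2 * n) n : ℝ)

lemma centralChoose_pos (n : ℕ) : (0 : ℝ) < (Nat.choose (2 * n) n : ℝ) := by
  exact_mod_cast Nat.choose_pos (by omega)

lemma tail_zero (n : ℕ) : tail n 0 = 1 := by
  simp only [tail, add_zero]
  exact div_self (centralChoose_pos n).ne'

lemma tail_succ_self (n : ℕ) : tail n (n + 1) = 0 := by
  simp [tail, Nat.choose_eq_zero_of_lt (show 2 * n < n + (n + 1) by omega)]

lemma tail_nonneg (n j : ℕ) : 0 ≤ tail n j := by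
  unfold tail; positivity

lemma tail_succ {n j : ℕ} (hj : j ≤ n) :
    ((n : ℝ) + j + 1) * tail n (j + 1) = ((n : ℝ) - j) * tail n j := by
  have key : ((Nat.choose (2 * n) (n + j + 1) : ℝ)) * ((n : ℝ) + j + 1)
      = (Nat.choose (2 * n) (n + j) : ℝ) * ((n : ℝ) - j) := by
    have h := Nat.choose_succ_right_eq (2 * n) (n + j)
    rw [show 2 * n - (n + j) = n - j by omega] at h
    have h' : ((Nat.choose (2 * n) (n + j + 1) * (n + j + 1) : ℕ) : ℝ)
      = ((Nat.choose (2 * n) (n + j) * (n - j) : ℕ) : ℝ) := by rw [h]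
    push_cast [Nat.cast_sub hj] at h'
    exact h'
  unfold tail
  rw [← add_assoc, mul_div_assoc', mul_div_assoc', mul_comm, key, mul_comm]

lemma tail_succ_le {n j : ℕ} (hj : j ≤ n) : tail n (j + 1) ≤ tail n j := by
  have h := tail_succ hj
  have h0 := tail_nonneg n j
  have hp : (0 : ℝ) < (n : ℝ) + j + 1 := by positivity
  have hj0 : (0 : ℝ) ≤ j := by positivity
  refine le_of_mul_le_mul_left ?_ hp
  rw [h]
  exact mul_le_mul_of_nonneg_right (by linarith) h0

lemma one_sub_div_one_add_le_exp {x : ℝ} (h0 : 0 ≤ x) (h1 : x < 1) :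
    (1 - x) / (1 + x) ≤ Real.exp (-(2 * x)) := by
  have h := Real.sum_range_le_log_div h0 h1 1
  simp only [Finset.sum_range_one, mul_zero, zero_add, pow_one, Nat.cast_zero, div_one] at h
  have hpos : 0 < (1 + x) / (1 - x) := div_pos (by linarith) (by linarith)
  have : Real.exp (2 * x) ≤ (1 + x) / (1 - x) := by
    rw [← Real.le_log_iff_exp_le hpos]; linarith
  rw [Real.exp_neg, ← inv_div]
  exact inv_anti₀ (Real.exp_pos _) this

lemma tail_le_exp {n j : ℕ} (hj : j ≤ n) :
    tail n j ≤ Real.exp (-((j : ℝ) ^ 2 / ((n : ℝ) + 1 / 2))) := by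
  induction j with
  | zero => simp [tail_zero]
  | succ j ih =>
    have ih := ih (by omega)
    have hn0 : (0 : ℝ) ≤ n := by positivity
    have hj0 : (0 : ℝ) ≤ j := by positivity
    have hjn : (j : ℝ) + 1 ≤ n := by exact_mod_cast hj
    have hp : (0 : ℝ) < (n : ℝ) + j + 1 := by positivity
    have e : tail n (j + 1) = ((n : ℝ) - j) / ((n : ℝ) + j + 1) * tail n j := by
      rw [div_mul_eq_mul_div, eq_div_iff hp.ne', ← tail_succ (by omega), mul_comm]
    have hx := one_sub_div_one_add_le_exp (x := (2 * (j : ℝ) + 1) / (2 * n + 1))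
      (by positivity) (by rw [div_lt_one (by positivity)]; linarith)
    have hr : (1 - (2 * (j : ℝ) + 1) / (2 * n + 1)) / (1 + (2 * (j : ℝ) + 1) / (2 * n + 1))
        = ((n : ℝ) - j) / ((n : ℝ) + j + 1) := by
      have h2 : (2 * (n : ℝ) + 1) ≠ 0 := by positivity
      have h3 : (1 + (2 * (j : ℝ) + 1) / (2 * n + 1)) ≠ 0 := by positivity
      rw [div_eq_div_iff h3 hp.ne']
      field_simp
      ring
    rw [hr] at hx
    rw [e]
    refine (mul_le_mul hx ih (tail_nonneg n j) (Real.exp_pos _).le).trans_eq ?_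
    rw [← Real.exp_add]
    congr 1
    push_cast
    field_simp
    ring

lemma sum_tail_sub (n N : ℕ) :
    ∑ j ∈ range N, (tail n j - tail n (j + 1)) = 1 - tail n N := by
  rw [Finset.sum_range_sub', tail_zero]

lemma sum_tail_sub_mul (n : ℕ) (a : ℕ → ℝ) (N : ℕ) :
    ∑ j ∈ range N, (tail n j - tail n (j + 1)) * a j + tail n N * a N
      = a 0 + ∑ j ∈ range N, tail n (j + 1) * (a (j + 1) - a j) := by
  induction N with
  | zero => simp [tail_zero]
  | succ N ih =>
    rw [Finset.sum_range_succ, Finset.sum_range_succ]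
    linear_combination ih

lemma sum_tail_sub_mul_quadratic {n N : ℕ} (hN : N ≤ n + 1) :
    ∑ j ∈ range N, (tail n j - tail n (j + 1)) * ((j : ℝ) * (j + 1))
      = n - (n + (N : ℝ) ^ 2) * tail n N := by
  induction N with
  | zero => simp [tail_zero]
  | succ N ih =>
    rw [Finset.sum_range_succ, ih (by omega)]
    have h := tail_succ (show N ≤ n by omega)
    push_cast
    linear_combination h

lemma integrableOn_const_mul_exp_neg (c a : ℝ) :
    IntegrableOn (fun t => c * Real.exp (-t)) (Set.Ioi a) :=
  (integrableOn_exp_neg_Ioi a).const_mul c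

lemma integrableOn_id_mul_exp_neg :
    IntegrableOn (fun t : ℝ => t * Real.exp (-t)) (Set.Ioi 0) := by
  have h := Real.GammaIntegral_convergent (s := 2) (by norm_num)
  refine h.congr_fun (fun t _ => ?_) measurableSet_Ioi
  norm_num [mul_comm]

lemma integral_id_mul_exp_neg : ∫ t in Set.Ioi (0 : ℝ), t * Real.exp (-t) = 1 := by
  have h := Real.Gamma_eq_integral (s := 2) (by norm_num)
  rw [Real.Gamma_two] at h
  rw [h]
  refine setIntegral_congr_fun measurableSet_Ioi (fun t _ => ?_)
  norm_num [mul_comm]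

lemma sum_exp_mul_sub_add_integral_le {f : ℝ → ℝ} (hf : Monotone f) {v : ℕ → ℝ}
    (hv : Monotone v) (hint : IntegrableOn (fun t => f t * Real.exp (-t)) (Set.Ioi (v 0)))
    (N : ℕ) :
    f (v 0) * Real.exp (-(v 0))
        + ∑ j ∈ range N, Real.exp (-(v (j + 1))) * (f (v (j + 1)) - f (v j))
      ≤ ∫ t in Set.Ioi (v 0), f t * Real.exp (-t) := by
  have hsub : ∀ N, IntegrableOn (fun t => f t * Real.exp (-t)) (Set.Ioi (v N)) := fun N =>
    hint.mono_set (Set.Ioi_subset_Ioi (hv (Nat.zero_le N)))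
  have hlast : f (v N) * Real.exp (-(v N)) ≤ ∫ t in Set.Ioi (v N), f t * Real.exp (-t) := by
    have : f (v N) * Real.exp (-(v N)) = ∫ t in Set.Ioi (v N), f (v N) * Real.exp (-t) := by
      rw [integral_const_mul, integral_exp_neg_Ioi]
    rw [this]
    refine setIntegral_mono_on (integrableOn_const_mul_exp_neg _ _) (hsub N) measurableSet_Ioi
      fun t ht => ?_
    exact mul_le_mul_of_nonneg_right (hf (le_of_lt ht)) (Real.exp_pos _).le
  have hstep : ∀ N, f (v 0) * Real.exp (-(v 0))
        + ∑ j ∈ range N, Real.exp (-(v (j + 1))) * (f (v (j + 1)) - f (v j))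
        + (∫ t in Set.Ioi (v N), f t * Real.exp (-t)) - f (v N) * Real.exp (-(v N))
      ≤ ∫ t in Set.Ioi (v 0), f t * Real.exp (-t) := by
    intro N
    induction N with
    | zero => simp
    | succ N ih =>
      have hle : v N ≤ v (N + 1) := hv (Nat.le_succ N)
      have hsplit : ∀ g : ℝ → ℝ, IntegrableOn g (Set.Ioi (v N)) →
          ∫ t in Set.Ioi (v N), g t
            = (∫ t in Set.Ioc (v N) (v (N + 1)), g t) + ∫ t in Set.Ioi (v (N + 1)), g t := by
        intro g hg
        rw [← Set.Ioc_union_Ioi_eq_Ioi hle]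
        exact setIntegral_union (Set.Ioc_disjoint_Ioi le_rfl) measurableSet_Ioi
          (hg.mono_set Set.Ioc_subset_Ioi_self) (hg.mono_set (Set.Ioi_subset_Ioi hle))
      have hmono : ∫ t in Set.Ioc (v N) (v (N + 1)), f (v N) * Real.exp (-t)
          ≤ ∫ t in Set.Ioc (v N) (v (N + 1)), f t * Real.exp (-t) := by
        refine setIntegral_mono_on
          ((integrableOn_const_mul_exp_neg _ _).mono_set Set.Ioc_subset_Ioi_self)
          ((hsub N).mono_set Set.Ioc_subset_Ioi_self) measurableSet_Ioc fun t ht => ?_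
        exact mul_le_mul_of_nonneg_right (hf ht.1.le) (Real.exp_pos _).le
      have hconst := hsplit _ (integrableOn_const_mul_exp_neg (f (v N)) (v N))
      rw [integral_const_mul, integral_const_mul, integral_const_mul, integral_exp_neg_Ioi,
        integral_exp_neg_Ioi] at hconst
      rw [integral_const_mul] at hmono
      rw [Finset.sum_range_succ]
      linarith [hsplit _ (hsub N)]
  linarith [hstep N]

/-- The square of `n - I`, divided by `n + 1/2`, is stochastically dominated by the standard
exponential distribution. -/
lemma sum_tail_sub_mul_le_integral (n : ℕ) {f : ℝ → ℝ} (hf : Monotone f)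
    (hint : IntegrableOn (fun t => f t * Real.exp (-t)) (Set.Ioi 0)) :
    ∑ j ∈ range (n + 1), (tail n j - tail n (j + 1)) * f ((j : ℝ) ^ 2 / ((n : ℝ) + 1 / 2))
      ≤ ∫ t in Set.Ioi (0 : ℝ), f t * Real.exp (-t) := by
  set v : ℕ → ℝ := fun j => (j : ℝ) ^ 2 / ((n : ℝ) + 1 / 2) with hvdef
  have hv : Monotone v := fun a b hab => by simp only [hvdef]; gcongr
  have hv0 : v 0 = 0 := by simp [hvdef]
  have h1 := sum_exp_mul_sub_add_integral_le hf hv (by rwa [hv0]) (n + 1)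
  have h2 := sum_tail_sub_mul n (fun j => f (v j)) (n + 1)
  rw [tail_succ_self, zero_mul, add_zero] at h2
  rw [h2]
  rw [hv0] at h1 ⊢
  rw [neg_zero, Real.exp_zero, mul_one] at h1
  refine le_trans (add_le_add_right (Finset.sum_le_sum fun j hj => ?_) _) h1
  refine mul_le_mul_of_nonneg_right ?_ (sub_nonneg.2 (hf (hv (Nat.le_succ j))))
  rcases (Nat.lt_succ_iff.1 (Finset.mem_range.1 hj)).lt_or_eq with hlt | rfl
  · exact tail_le_exp hlt
  · rw [tail_succ_self]; exact (Real.exp_pos _).le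

lemma abs_sum_tail_sub_mul_sub_integral_le (n : ℕ) {h : ℝ → ℝ}
    (hL : ∀ x y, |h y - h x| ≤ |y - x|)
    (hint : IntegrableOn (fun t => h t * Real.exp (-t)) (Set.Ioi 0)) :
    |(∑ j ∈ range (n + 1), (tail n j - tail n (j + 1)) * h ((j : ℝ) ^ 2 / ((n : ℝ) + 1 / 2)))
        - ∫ t in Set.Ioi (0 : ℝ), h t * Real.exp (-t)|
      ≤ 1 - ∑ j ∈ range (n + 1),
          (tail n j - tail n (j + 1)) * ((j : ℝ) ^ 2 / ((n : ℝ) + 1 / 2)) := by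
  have hadd : Monotone fun t => t + h t := fun x y hxy => by
    have := (abs_le.1 ((hL x y).trans_eq (abs_of_nonneg (sub_nonneg.2 hxy)))).1
    change x + h x ≤ y + h y
    linarith
  have hsub : Monotone fun t => t - h t := fun x y hxy => by
    have := (abs_le.1 ((hL x y).trans_eq (abs_of_nonneg (sub_nonneg.2 hxy)))).2
    change x - h x ≤ y - h y
    linarith
  have h1 := sum_tail_sub_mul_le_integral n hadd
    ((integrableOn_id_mul_exp_neg.add hint).congr_fun
      (fun t _ => (add_mul t (h t) _).symm) measurableSet_Ioi)
  have h2 := sum_tail_sub_mul_le_integral n hsub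
    ((integrableOn_id_mul_exp_neg.sub hint).congr_fun
      (fun t _ => (sub_mul t (h t) _).symm) measurableSet_Ioi)
  simp only [add_mul, mul_add, Finset.sum_add_distrib] at h1
  simp only [sub_mul _ (h _), mul_sub, Finset.sum_sub_distrib] at h2
  rw [integral_add integrableOn_id_mul_exp_neg hint, integral_id_mul_exp_neg] at h1
  simp only [sub_mul] at h1 h2 ⊢
  rw [integral_sub integrableOn_id_mul_exp_neg hint, integral_id_mul_exp_neg] at h2
  rw [abs_le]
  constructor <;> linarith

lemma sum_eigenvalue_eq_sum_tail (n : ℕ) (g : ℝ → ℝ) :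
    (∑ i : Fin (n + 1),
        (((Nat.choose (2 * n) i : ℝ)
            - (if (i : ℕ) = 0 then 0 else (Nat.choose (2 * n) ((i : ℕ) - 1) : ℝ)))
          / (Nat.choose (2 * n) n : ℝ))
          * g (((n : ℝ) - (i : ℕ)) * ((n : ℝ) + 1 - (i : ℕ)) / (n : ℝ)))
      = ∑ j ∈ range (n + 1), (tail n j - tail n (j + 1)) * g ((j : ℝ) * (j + 1) / n) := by
  rw [Fin.sum_univ_eq_sum_range (fun i : ℕ =>
        (((Nat.choose (2 * n) i : ℝ)
            - (if i = 0 then 0 else (Nat.choose (2 * n) (i - 1) : ℝ)))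
          / (Nat.choose (2 * n) n : ℝ))
          * g (((n : ℝ) - i) * ((n : ℝ) + 1 - i) / (n : ℝ))) (n + 1),
    ← Finset.sum_range_reflect]
  refine Finset.sum_congr rfl fun j hj => ?_
  have hj : j ≤ n := Nat.lt_succ_iff.1 (Finset.mem_range.1 hj)
  rw [show n + 1 - 1 - j = n - j by omega, Nat.cast_sub hj]
  have e1 : Nat.choose (2 * n) (n - j) = Nat.choose (2 * n) (n + j) := by
    rw [← Nat.choose_symm (show n + j ≤ 2 * n by omega)]
    congr 1; omega
  have e2 : (if n - j = 0 then 0 else (Nat.choose (2 * n) (n - j - 1) : ℝ))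
      = Nat.choose (2 * n) (n + (j + 1)) := by
    split_ifs with h
    · rw [Nat.choose_eq_zero_of_lt (by omega), Nat.cast_zero]
    · rw [← Nat.choose_symm (show n + (j + 1) ≤ 2 * n by omega)]
      congr 2; omega
  rw [e1, e2, tail, tail, sub_div]
  congr 2
  ring

lemma abs_sum_tail_sub_mul_sub_le {n : ℕ} (hn : 0 < n) {h : ℝ → ℝ}
    (hL : ∀ x y, |h y - h x| ≤ |y - x|) :
    |(∑ j ∈ range (n + 1), (tail n j - tail n (j + 1)) * h ((j : ℝ) * (j + 1) / n))
        - ∑ j ∈ range (n + 1),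
          (tail n j - tail n (j + 1)) * h ((j : ℝ) ^ 2 / ((n : ℝ) + 1 / 2))|
      ≤ 1 - ∑ j ∈ range (n + 1),
          (tail n j - tail n (j + 1)) * ((j : ℝ) ^ 2 / ((n : ℝ) + 1 / 2)) := by
  have hn' : (0 : ℝ) < n := by exact_mod_cast hn
  have hmean : ∑ j ∈ range (n + 1), (tail n j - tail n (j + 1)) * ((j : ℝ) * (j + 1) / n)
      = 1 := by
    simp only [← mul_div_assoc, ← Finset.sum_div]
    rw [sum_tail_sub_mul_quadratic le_rfl, tail_succ_self, mul_zero, sub_zero,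
      div_self hn'.ne']
  rw [← Finset.sum_sub_distrib]
  refine (Finset.abs_sum_le_sum_abs _ _).trans
    ((Finset.sum_le_sum fun j hj => ?_).trans_eq
      ((Finset.sum_sub_distrib _ _).trans (congrArg (· - _) hmean)))
  have hp := sub_nonneg.2 (tail_succ_le (Nat.lt_succ_iff.1 (Finset.mem_range.1 hj)))
  rw [← mul_sub, ← mul_sub, abs_mul, abs_of_nonneg hp]
  refine mul_le_mul_of_nonneg_left ((hL _ _).trans_eq (abs_of_nonneg (sub_nonneg.2 ?_))) hp
  have hj0 : (0 : ℝ) ≤ j := by positivity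
  exact div_le_div₀ (by positivity) (by nlinarith) hn' (by linarith)

lemma one_sub_sum_tail_sub_mul_sq_le {n : ℕ} (hn : 0 < n) :
    1 - ∑ j ∈ range (n + 1), (tail n j - tail n (j + 1)) * ((j : ℝ) ^ 2 / ((n : ℝ) + 1 / 2))
      ≤ 3 / 2 / √n := by
  have hn' : (1 : ℝ) ≤ n := by exact_mod_cast hn
  set s := ∑ j ∈ range (n + 1), (tail n j - tail n (j + 1)) * (j : ℝ) with hs
  set q := ∑ j ∈ range (n + 1), (tail n j - tail n (j + 1)) * (j : ℝ) ^ 2 with hq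
  have hone := sum_tail_sub n (n + 1)
  rw [tail_succ_self, sub_zero] at hone
  have hqs : q + s = n := by
    have := sum_tail_sub_mul_quadratic (n := n) le_rfl
    rw [tail_succ_self, mul_zero, sub_zero] at this
    rw [← this, hs, hq, ← Finset.sum_add_distrib]
    exact Finset.sum_congr rfl fun j _ => by ring
  have hp : ∀ j ∈ range (n + 1), 0 ≤ tail n j - tail n (j + 1) := fun j hj =>
    sub_nonneg.2 (tail_succ_le (Nat.lt_succ_iff.1 (Finset.mem_range.1 hj)))
  have hs0 : 0 ≤ s := Finset.sum_nonneg fun j hj => mul_nonneg (hp j hj) (by positivity)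
  have hvar : s ^ 2 ≤ q := by
    have h0 : 0 ≤ ∑ j ∈ range (n + 1), (tail n j - tail n (j + 1)) * ((j : ℝ) - s) ^ 2 :=
      Finset.sum_nonneg fun j hj => mul_nonneg (hp j hj) (sq_nonneg _)
    have h1 : ∑ j ∈ range (n + 1), (tail n j - tail n (j + 1)) * ((j : ℝ) - s) ^ 2
        = q - 2 * s * s + s ^ 2 * 1 := by
      calc _ = ∑ j ∈ range (n + 1), ((tail n j - tail n (j + 1)) * (j : ℝ) ^ 2
              - 2 * s * ((tail n j - tail n (j + 1)) * (j : ℝ))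
              + s ^ 2 * (tail n j - tail n (j + 1))) :=
            Finset.sum_congr rfl fun j _ => by ring
        _ = _ := by
            rw [Finset.sum_add_distrib, Finset.sum_sub_distrib, ← Finset.mul_sum,
              ← Finset.mul_sum, hone]
    nlinarith
  have hsqrt : s ≤ √n := Real.le_sqrt_of_sq_le (by linarith)
  have hr1 : 1 ≤ √(n : ℝ) := Real.one_le_sqrt.2 hn'
  have hrr : √(n : ℝ) * √n = n := Real.mul_self_sqrt (by linarith)
  simp only [← mul_div_assoc, ← Finset.sum_div]
  rw [← hq, one_sub_div (by positivity), div_le_div_iff₀ (by positivity) (by positivity)]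
  nlinarith

end BernoulliLaplace

open BernoulliLaplace

/-- **Theorem 3.2** (Chatterjee–Shao). Exponential approximation for the random eigenvalue
of the Bernoulli–Laplace Markov chain: with I distributed on {0,…,n} in proportion to the
multiplicities π_i = (C(2n,i) - C(2n,i-1))/C(2n,n) (with C(2n,-1) = 0), and
W = (n - I)(n + 1 - I)/n, for every absolutely continuous h with ‖h'‖ ≤ 1 one has
|E h(W) - E h(Y)| ≤ 12 n^{-1/2}, where Y is exponential with mean 1. -/
theorem bernoulliLaplace_spectrum_exponential_approx
    (n : ℕ) (hn : 0 < n)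
    (h h' : ℝ → ℝ)
    (hhAC : ∀ x y : ℝ, h y - h x = ∫ t in x..y, h' t)
    (hh'B : ∀ x, |h' x| ≤ 1)
    (hhInt : IntegrableOn (fun t => h t * Real.exp (-t)) (Set.Ioi (0 : ℝ))) :
    |(∑ i : Fin (n + 1),
        (((Nat.choose (2 * n) i : ℝ)
            - (if (i : ℕ) = 0 then 0 else (Nat.choose (2 * n) ((i : ℕ) - 1) : ℝ)))
          / (Nat.choose (2 * n) n : ℝ))
          * h (((n : ℝ) - (i : ℕ)) * ((n : ℝ) + 1 - (i : ℕ)) / (n : ℝ)))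
      - ∫ t in Set.Ioi (0 : ℝ), h t * Real.exp (-t)|
      ≤ 12 * (n : ℝ) ^ (-(1 : ℝ) / 2) := by
  have hL : ∀ x y, |h y - h x| ≤ |y - x| := fun x y => by
    rw [hhAC x y]
    simpa using intervalIntegral.norm_integral_le_of_norm_le_const (f := h') (C := 1)
      (a := x) (b := y) fun t _ => hh'B t
  have hpow : (n : ℝ) ^ (-(1 : ℝ) / 2) = 1 / √n := by
    rw [neg_div, Real.rpow_neg (by positivity), ← Real.sqrt_eq_rpow, one_div]
  rw [sum_eigenvalue_eq_sum_tail, hpow]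
  refine (abs_sub_le _ _ _).trans ((add_le_add (abs_sum_tail_sub_mul_sub_le hn hL)
    (abs_sum_tail_sub_mul_sub_integral_le n hL hhInt)).trans ?_)
  have hV := one_sub_sum_tail_sub_mul_sq_le hn
  have h0 : 0 ≤ 1 / √(n : ℝ) := by positivity
  have hc : 3 / 2 / √(n : ℝ) = 3 / 2 * (1 / √n) := by ring
  linarith
end

section
/- Let p be a strictly positive, absolutely continuous probability density on (a,b), F(x) = ∫_a^x p(t) dt, and let h be a bounded measurable function with Stein solution f_h(w) = (1/p(w)) ∫_a^w (h(t) − E h(Y)) p(t) dt. Assume there exist constants d₁ > 0 and d₂ > 0 such that for all x: min(1 − F(x), F(x)) ≤ d₁ p(x), and |p'(x)|·min(F(x), 1 − F(x)) ≤ d₂ p(x)². Then: (1) ‖f_h‖ ≤ 2 d₁ ‖h‖; (2) ‖f_h · p'/p‖ ≤ 2 d₂ ‖h‖; (3) ‖f_h'‖ ≤ (2 + 2 d₂) ‖h‖. -/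
open MeasureTheory

/-- The Stein solution f_h(w) = (1/p(w)) ∫_a^w (h(t) - E h(Y)) p(t) dt, for a density p
supported on the set `S`. -/
noncomputable def steinSolution (S : Set ℝ) (p h : ℝ → ℝ) (w : ℝ) : ℝ :=
  (∫ t in S ∩ Set.Iio w, (h t - ∫ x in S, h x * p x) * p t) / p w

/-- A function dominated by `C • p` and of integral zero has partial integrals bounded by `C` times
the smaller of the two tails of `p`. -/
lemma abs_setIntegral_Iio_le_mul_min {S : Set ℝ} (hS : MeasurableSet S) {p g : ℝ → ℝ} {C : ℝ}
    (hp : IntegrableOn p S) (hp1 : ∫ x in S, p x = 1) (hg : IntegrableOn g S)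
    (hg0 : ∫ x in S, g x = 0) (hgp : ∀ x ∈ S, |g x| ≤ C * p x) (w : ℝ) :
    |∫ t in S ∩ Set.Iio w, g t| ≤
      C * min (∫ t in S ∩ Set.Iic w, p t) (1 - ∫ t in S ∩ Set.Iic w, p t) := by
  have bound : ∀ T ⊆ S, MeasurableSet T → |∫ t in T, g t| ≤ C * ∫ t in T, p t := by
    intro T hTS hT
    rw [← integral_const_mul, ← Real.norm_eq_abs]
    refine norm_integral_le_of_norm_le ((hp.mono_set hTS).const_mul C) ?_
    filter_upwards [ae_restrict_mem hT] with x hx using hgp x (hTS hx)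
  have hIio : (S ∩ Set.Iio w : Set ℝ) =ᵐ[volume] (S ∩ Set.Iic w : Set ℝ) :=
    (ae_eq_refl S).inter Iio_ae_eq_Iic
  have hdiff : S \ Set.Iic w ⊆ S := Set.sdiff_subset
  have hgsplit := integral_inter_add_sdiff (measurableSet_Iic (a := w)) hg
  have hpsplit := integral_inter_add_sdiff (measurableSet_Iic (a := w)) hp
  have hlower := bound _ Set.inter_subset_left (hS.inter (measurableSet_Iic (a := w)))
  have hupper := bound _ hdiff (hS.diff (measurableSet_Iic (a := w)))
  rw [setIntegral_congr_set hIio]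
  rcases min_choice (∫ t in S ∩ Set.Iic w, p t) (1 - ∫ t in S ∩ Set.Iic w, p t) with hm | hm
  · rwa [hm]
  · rw [hm, ← hp1, ← hpsplit, add_sub_cancel_left, ← abs_neg]
    rwa [show -(∫ t in S ∩ Set.Iic w, g t) = ∫ t in S \ Set.Iic w, g t by linarith]

/-- For a function bounded by `H`, the mean under the density `p` is at most `H` in absolute value,
and the numerator of the Stein solution is at most `2 * H` times the
smaller of the two tails of the density. -/
lemma abs_setIntegral_sub_mean_mul_le {S : Set ℝ} (hS : MeasurableSet S) {p h : ℝ → ℝ} {H : ℝ}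
    (hp0 : ∀ x ∈ S, 0 ≤ p x) (hp1 : ∫ x in S, p x = 1) (hh : Measurable h)
    (hH : ∀ x ∈ S, |h x| ≤ H) :
    |∫ x in S, h x * p x| ≤ H ∧ ∀ w : ℝ,
      |∫ t in S ∩ Set.Iio w, (h t - ∫ x in S, h x * p x) * p t| ≤
        2 * H * min (∫ t in S ∩ Set.Iic w, p t) (1 - ∫ t in S ∩ Set.Iic w, p t) := by
  have hp : IntegrableOn p S := by
    by_contra hn
    rw [integral_undef hn] at hp1
    exact zero_ne_one hp1
  have hhp : IntegrableOn (fun x => h x * p x) S := by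
    refine hp.bdd_mul (c := H) hh.aestronglyMeasurable ?_
    filter_upwards [ae_restrict_mem hS] with x hx using hH x hx
  have hmean : |∫ x in S, h x * p x| ≤ H := by
    have hle : ‖∫ x in S, h x * p x‖ ≤ ∫ x in S, H * p x := by
      refine norm_integral_le_of_norm_le (hp.const_mul H) ?_
      filter_upwards [ae_restrict_mem hS] with x hx
      rw [Real.norm_eq_abs, abs_mul, abs_of_nonneg (hp0 x hx)]
      exact mul_le_mul_of_nonneg_right (hH x hx) (hp0 x hx)
    rwa [integral_const_mul, hp1, mul_one] at hle
  refine ⟨hmean, ?_⟩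
  set m := ∫ x in S, h x * p x with hm
  refine abs_setIntegral_Iio_le_mul_min hS hp hp1 ?_ ?_ ?_
  · simp only [sub_mul]
    exact hhp.sub (hp.const_mul m)
  · simp only [sub_mul]
    rw [integral_sub hhp (hp.const_mul m), integral_const_mul, hp1, ← hm, mul_one, sub_self]
  · intro x hx
    rw [abs_mul, abs_of_nonneg (hp0 x hx)]
    refine mul_le_mul_of_nonneg_right ?_ (hp0 x hx)
    linarith [abs_sub (h x) m, hH x hx]

/-- **Lemma 4.1(i)** (Chatterjee–Shao). Bounds on the Stein solution f_h for bounded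
measurable h: if min(1-F, F) ≤ d₁ p and |p'|·min(F, 1-F) ≤ d₂ p², then ‖f_h‖ ≤ 2d₁‖h‖,
‖f_h p'/p‖ ≤ 2d₂‖h‖ and ‖f_h'‖ ≤ (2+2d₂)‖h‖, where by the Stein equation
f_h'(w) = h(w) - E h(Y) - f_h(w) p'(w)/p(w). Here S = (a,b) with EReal endpoints,
F(x) = ∫_a^x p(t) dt, and H is a bound for sup |h| on S. -/
theorem steinSolution_bounds_of_bounded_h
    (a b : EReal) (hab : a < b)
    (p p' : ℝ → ℝ)
    (hppos : ∀ x : ℝ, a < (x : EReal) → (x : EReal) < b → 0 < p x)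
    (hpsupp : ∀ x : ℝ, ¬(a < (x : EReal) ∧ (x : EReal) < b) → p x = 0)
    (hpAC : ∀ x : ℝ, a < (x : EReal) → (x : EReal) < b →
      ∀ y : ℝ, a < (y : EReal) → (y : EReal) < b →
        p y - p x = ∫ t in x..y, p' t)
    (hp'int : IntegrableOn p' {x : ℝ | a < (x : EReal) ∧ (x : EReal) < b})
    (hpdens : (∫ x in {x : ℝ | a < (x : EReal) ∧ (x : EReal) < b}, p x) = 1)
    -- h is bounded and measurable, with |h| ≤ H on S
    (h : ℝ → ℝ) (hhmeas : Measurable h) (H : ℝ)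
    (hhbd : ∀ x : ℝ, a < (x : EReal) → (x : EReal) < b → |h x| ≤ H)
    -- the hypotheses (4.10) and (4.11): with F(x) = ∫_a^x p,
    -- min(1-F, F) ≤ d₁ p and |p'| min(F, 1-F) ≤ d₂ p²
    (d₁ d₂ : ℝ) (hd₁ : 0 < d₁) (hd₂ : 0 < d₂)
    (hF1 : ∀ x : ℝ,
      min (1 - ∫ t in {y : ℝ | a < (y : EReal) ∧ (y : EReal) < b} ∩ Set.Iic x, p t)
          (∫ t in {y : ℝ | a < (y : EReal) ∧ (y : EReal) < b} ∩ Set.Iic x, p t)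
        ≤ d₁ * p x)
    (hF2 : ∀ x : ℝ,
      |p' x| * min (∫ t in {y : ℝ | a < (y : EReal) ∧ (y : EReal) < b} ∩ Set.Iic x, p t)
          (1 - ∫ t in {y : ℝ | a < (y : EReal) ∧ (y : EReal) < b} ∩ Set.Iic x, p t)
        ≤ d₂ * p x ^ 2) :
    ∀ w : ℝ, a < (w : EReal) → (w : EReal) < b →
      (|steinSolution {x : ℝ | a < (x : EReal) ∧ (x : EReal) < b} p h w| ≤ 2 * d₁ * H)
      ∧ (|steinSolution {x : ℝ | a < (x : EReal) ∧ (x : EReal) < b} p h w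
            * (p' w / p w)| ≤ 2 * d₂ * H)
      ∧ |h w - (∫ x in {x : ℝ | a < (x : EReal) ∧ (x : EReal) < b}, h x * p x)
            - steinSolution {x : ℝ | a < (x : EReal) ∧ (x : EReal) < b} p h w
              * (p' w / p w)|
          ≤ (2 + 2 * d₂) * H := by
  intro w haw hwb
  set S : Set ℝ := {x : ℝ | a < (x : EReal) ∧ (x : EReal) < b}
  have hS : MeasurableSet S :=
    (measurableSet_lt measurable_const measurable_coe_real_ereal).inter
      (measurableSet_lt measurable_coe_real_ereal measurable_const)
  obtain ⟨hmean, hnum⟩ := abs_setIntegral_sub_mean_mul_le hS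
    (fun x hx => (hppos x hx.1 hx.2).le) hpdens hhmeas (fun x hx => hhbd x hx.1 hx.2)
  have hpw := hppos w haw hwb
  have hhw := hhbd w haw hwb
  have hH : 0 ≤ H := (abs_nonneg _).trans hhw
  have hF1w := hF1 w
  rw [min_comm] at hF1w
  have hF2w := hF2 w
  have hnumw := hnum w
  set M := min (∫ t in S ∩ Set.Iic w, p t) (1 - ∫ t in S ∩ Set.Iic w, p t)
  have hprod : |steinSolution S p h w * (p' w / p w)| ≤ 2 * d₂ * H := by
    rw [steinSolution, div_mul_div_comm, abs_div, abs_mul, abs_of_pos (mul_pos hpw hpw),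
      div_le_iff₀ (mul_pos hpw hpw)]
    calc _ ≤ 2 * H * M * |p' w| := mul_le_mul_of_nonneg_right hnumw (abs_nonneg _)
      _ = 2 * H * (|p' w| * M) := by ring
      _ ≤ 2 * H * (d₂ * p w ^ 2) := mul_le_mul_of_nonneg_left hF2w (by positivity)
      _ = _ := by ring
  refine ⟨?_, hprod, ?_⟩
  · rw [steinSolution, abs_div, abs_of_pos hpw, div_le_iff₀ hpw]
    calc _ ≤ 2 * H * M := hnumw
      _ ≤ 2 * H * (d₁ * p w) := mul_le_mul_of_nonneg_left hF1w (by positivity)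
      _ = _ := by ring
  · have h₁ := abs_sub (h w - ∫ x in S, h x * p x) (steinSolution S p h w * (p' w / p w))
    have h₂ := abs_sub (h w) (∫ x in S, h x * p x)
    linarith
end

section
/- Let g: ℝ → ℝ satisfy (H1), let G(t) = ∫₀ᵗ g(s) ds, c₀ > 0, c₁ = 1/∫_{−∞}^{∞} e^{−c₀ G(t)} dt (assumed finite and positive), p(t) = c₁ e^{−c₀ G(t)}, and F(x) = ∫_{−∞}^x p(t) dt. Then for all t ≤ 0, F(t) ≤ F(0)·p(t)/c₁, and for all t ≥ 0, 1 − F(t) ≤ (1 − F(0))·p(t)/c₁. In particular, min(F(x), 1 − F(x)) ≤ p(x)/c₁ for all x ∈ ℝ. -/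
open MeasureTheory

/-- A primitive of a monotone function is superadditive on nonnegative arguments. -/
theorem Monotone.integral_add_integral_le_of_nonneg {g : ℝ → ℝ} (hg : Monotone g) {s t : ℝ}
    (hs : 0 ≤ s) (ht : 0 ≤ t) :
    (∫ x in (0:ℝ)..s, g x) + ∫ x in (0:ℝ)..t, g x ≤ ∫ x in (0:ℝ)..(s + t), g x := by
  have hadj := intervalIntegral.integral_add_adjacent_intervals
    (hg.intervalIntegrable (μ := volume) (a := 0) (b := t))
    (hg.intervalIntegrable (μ := volume) (a := t) (b := s + t))
  have hshift := intervalIntegral.integral_comp_add_right (a := 0) (b := s) g t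
  rw [zero_add] at hshift
  have hle : ∫ x in (0:ℝ)..s, g x ≤ ∫ x in (0:ℝ)..s, g (x + t) :=
    intervalIntegral.integral_mono_on hs hg.intervalIntegrable
      (hg.comp (monotone_id.add_const t)).intervalIntegrable
      fun x _ => hg (le_add_of_nonneg_right ht)
  linarith

/-- A primitive of a monotone function is superadditive on nonpositive arguments. -/
theorem Monotone.integral_add_integral_le_of_nonpos {g : ℝ → ℝ} (hg : Monotone g) {s t : ℝ}
    (hs : s ≤ 0) (ht : t ≤ 0) :
    (∫ x in (0:ℝ)..s, g x) + ∫ x in (0:ℝ)..t, g x ≤ ∫ x in (0:ℝ)..(s + t), g x := by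
  have hreflect : Monotone fun x => -g (-x) := fun _ _ h => neg_le_neg (hg (neg_le_neg h))
  have h := hreflect.integral_add_integral_le_of_nonneg (neg_nonneg.2 hs) (neg_nonneg.2 ht)
  have hprim : ∀ a : ℝ, ∫ x in (0:ℝ)..(-a), -g (-x) = ∫ x in (0:ℝ)..a, g x := fun a => by
    rw [intervalIntegral.integral_neg, intervalIntegral.integral_comp_neg, neg_neg, neg_zero,
      intervalIntegral.integral_symm, neg_neg]
  rwa [← neg_add_rev, add_comm t s, hprim, hprim, hprim] at h

/-- If `f (u + t) ≤ f u * a` for `u ∈ S`, then the integral of `f` over a set whose translate by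
`-t` is `S` is at most `a` times its integral over `S`. -/
theorem setIntegral_le_mul_of_translate_le {f : ℝ → ℝ} (hf : Integrable f) {S T : Set ℝ}
    (hS : MeasurableSet S) {t a : ℝ} (hST : (fun u => u + t) ⁻¹' T = S)
    (h : ∀ u ∈ S, f (u + t) ≤ f u * a) :
    ∫ u in T, f u ≤ (∫ u in S, f u) * a := by
  rw [← (measurePreserving_add_right volume t).setIntegral_preimage_emb
    (measurableEmbedding_addRight t) f T, hST, ← integral_mul_const]
  exact setIntegral_mono_on (hf.comp_add_right t).integrableOn (hf.mul_const a).integrableOn hS h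

/-- **Lemma 4.2, first part** (Chatterjee–Shao). For the density p(t) = c₁ e^{-c₀ G(t)},
G(t) = ∫₀ᵗ g, under (H1): F(t) ≤ F(0) p(t)/c₁ for t ≤ 0, 1 - F(t) ≤ (1-F(0)) p(t)/c₁ for
t ≥ 0, and in particular min(F, 1-F) ≤ p/c₁. -/
theorem density_tail_bound_H1
    (g : ℝ → ℝ) (c₀ c₁ : ℝ) (hc₀ : 0 < c₀) (hc₁pos : 0 < c₁)
    -- (H1)
    (hmono : Monotone g) (hgpos : ∀ t, 0 < t → 0 ≤ g t) (hgneg : ∀ t, t ≤ 0 → g t ≤ 0)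
    (hpInt : Integrable (fun t => Real.exp (-(c₀ * ∫ s in (0:ℝ)..t, g s))))
    (hc₁ : c₁ = (∫ t : ℝ, Real.exp (-(c₀ * ∫ s in (0:ℝ)..t, g s)))⁻¹) :
    (∀ t : ℝ, t ≤ 0 →
      (∫ u in Set.Iic t, c₁ * Real.exp (-(c₀ * ∫ s in (0:ℝ)..u, g s)))
        ≤ (∫ u in Set.Iic (0:ℝ), c₁ * Real.exp (-(c₀ * ∫ s in (0:ℝ)..u, g s)))
            * (c₁ * Real.exp (-(c₀ * ∫ s in (0:ℝ)..t, g s))) / c₁)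
    ∧ (∀ t : ℝ, 0 ≤ t →
      1 - (∫ u in Set.Iic t, c₁ * Real.exp (-(c₀ * ∫ s in (0:ℝ)..u, g s)))
        ≤ (1 - ∫ u in Set.Iic (0:ℝ), c₁ * Real.exp (-(c₀ * ∫ s in (0:ℝ)..u, g s)))
            * (c₁ * Real.exp (-(c₀ * ∫ s in (0:ℝ)..t, g s))) / c₁)
    ∧ ∀ x : ℝ,
      min (∫ u in Set.Iic x, c₁ * Real.exp (-(c₀ * ∫ s in (0:ℝ)..u, g s)))
          (1 - ∫ u in Set.Iic x, c₁ * Real.exp (-(c₀ * ∫ s in (0:ℝ)..u, g s)))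
        ≤ (c₁ * Real.exp (-(c₀ * ∫ s in (0:ℝ)..x, g s))) / c₁ := by
  set p : ℝ → ℝ := fun u => c₁ * Real.exp (-(c₀ * ∫ s in (0:ℝ)..u, g s)) with hp
  have hp_nonneg : ∀ u, 0 ≤ p u := fun u => by positivity
  have hp_int : Integrable p := hpInt.const_mul c₁
  have hp_total : ∫ u, p u = 1 := by
    rw [hp, integral_const_mul, ← inv_inv (∫ t : ℝ, _), ← hc₁, mul_inv_cancel₀ hc₁pos.ne']
  have hsurv : ∀ t, 1 - ∫ u in Set.Iic t, p u = ∫ u in Set.Ioi t, p u := fun t => by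
    rw [← hp_total, ← intervalIntegral.integral_Iic_add_Ioi hp_int.integrableOn hp_int.integrableOn,
      add_sub_cancel_left]
  have hsubmul : ∀ u t, (∫ s in (0:ℝ)..u, g s) + (∫ s in (0:ℝ)..t, g s)
      ≤ ∫ s in (0:ℝ)..(u + t), g s → p (u + t) ≤ p u * (p t / c₁) := fun u t h => by
    simp only [hp]
    rw [mul_div_cancel_left₀ _ hc₁pos.ne', mul_assoc, ← Real.exp_add]
    gcongr
    nlinarith [mul_le_mul_of_nonneg_left h hc₀.le]
  have hlower : ∀ t ≤ 0, ∫ u in Set.Iic t, p u ≤ (∫ u in Set.Iic (0:ℝ), p u) * p t / c₁ :=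
    fun t ht => by
      rw [mul_div_assoc]
      exact setIntegral_le_mul_of_translate_le hp_int measurableSet_Iic (t := t)
        (by ext; simp) fun u hu =>
          hsubmul u t (hmono.integral_add_integral_le_of_nonpos hu ht)
  have hupper : ∀ t, 0 ≤ t → 1 - ∫ u in Set.Iic t, p u
      ≤ (1 - ∫ u in Set.Iic (0:ℝ), p u) * p t / c₁ :=
    fun t ht => by
      rw [mul_div_assoc, hsurv, hsurv]
      exact setIntegral_le_mul_of_translate_le hp_int measurableSet_Ioi (t := t)
        (by ext; simp) fun u hu =>
          hsubmul u t (hmono.integral_add_integral_le_of_nonneg (le_of_lt hu) ht)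
  have hF_nonneg : 0 ≤ ∫ u in Set.Iic (0:ℝ), p u := integral_nonneg hp_nonneg
  have hS_nonneg : 0 ≤ 1 - ∫ u in Set.Iic (0:ℝ), p u := hsurv 0 ▸ integral_nonneg hp_nonneg
  refine ⟨hlower, hupper, fun x => ?_⟩
  have hpx : 0 ≤ p x / c₁ := div_nonneg (hp_nonneg x) hc₁pos.le
  rcases le_total x 0 with hx | hx
  · refine (min_le_left _ _).trans ((hlower x hx).trans ?_)
    rw [mul_div_assoc]
    exact mul_le_of_le_one_left hpx (by linarith)
  · refine (min_le_right _ _).trans ((hupper x hx).trans ?_)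
    rw [mul_div_assoc]
    exact mul_le_of_le_one_left hpx (by linarith)
end

section
/- Let g: ℝ → ℝ satisfy (H1), let G(t) = ∫₀ᵗ g(s) ds, c₀ > 0, c₁ = 1/∫_{−∞}^{∞} e^{−c₀ G(t)} dt (assumed finite and positive), p(t) = c₁ e^{−c₀ G(t)}, and F(x) = ∫_{−∞}^x p(t) dt. Then for all t < 0 with g(t) ≠ 0, F(t) ≤ p(t)/(c₀ |g(t)|), and for all t > 0 with g(t) ≠ 0, 1 − F(t) ≤ p(t)/(c₀ g(t)). Consequently, |p'(x)|·min(F(x), 1 − F(x)) ≤ p(x)² for all x, where p'(x) = −c₀ g(x) p(x). -/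
open MeasureTheory

theorem Monotone.mul_sub_le_intervalIntegral {g : ℝ → ℝ} (hg : Monotone g) (t u : ℝ) :
    g t * (u - t) ≤ ∫ s in t..u, g s := by
  rcases le_total t u with h | h
  · have := intervalIntegral.integral_mono_on (μ := volume) h
      intervalIntegrable_const hg.intervalIntegrable
      (fun s hs => hg hs.1 : ∀ s ∈ Set.Icc t u, (fun _ => g t) s ≤ g s)
    simp only [intervalIntegral.integral_const, smul_eq_mul] at this
    linarith
  · have := intervalIntegral.integral_mono_on (μ := volume) h hg.intervalIntegrable
      intervalIntegrable_const
      (fun s hs => hg hs.2 : ∀ s ∈ Set.Icc u t, g s ≤ (fun _ => g t) s)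
    simp only [intervalIntegral.integral_const, smul_eq_mul] at this
    rw [intervalIntegral.integral_symm]
    linarith

theorem setIntegral_Iic_le_div_of_le_mul_exp {q : ℝ → ℝ} {a t : ℝ} (hq : Integrable q)
    (ha : 0 < a) (h : ∀ u, q u ≤ q t * Real.exp (a * (u - t))) :
    ∫ u in Set.Iic t, q u ≤ q t / a := by
  have e : (fun u => q t * Real.exp (a * (u - t))) =
      fun u => q t * Real.exp (-(a * t)) * Real.exp (a * u) := by
    ext u
    rw [mul_assoc, ← Real.exp_add]
    ring_nf
  refine (setIntegral_mono hq.integrableOn ?_ h).trans_eq ?_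
  · rw [e]
    exact (integrableOn_exp_mul_Iic ha t).const_mul _
  · rw [e, integral_const_mul, integral_exp_mul_Iic ha, mul_assoc, mul_div_assoc', ← Real.exp_add]
    simp [div_eq_mul_inv]

theorem setIntegral_Ioi_le_div_of_le_mul_exp {q : ℝ → ℝ} {a t : ℝ} (hq : Integrable q)
    (ha : 0 < a) (h : ∀ u, q u ≤ q t * Real.exp (-a * (u - t))) :
    ∫ u in Set.Ioi t, q u ≤ q t / a := by
  have hr := setIntegral_Iic_le_div_of_le_mul_exp (q := fun u => q (-u)) (t := -t) hq.comp_neg ha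
    (fun u => by simpa using (h (-u)).trans_eq (by ring_nf))
  simpa [integral_comp_neg_Iic] using hr

/-- **Lemma 4.2, second part** (Chatterjee–Shao). For the density p(t) = c₁ e^{-c₀ G(t)},
G(t) = ∫₀ᵗ g, under (H1): F(t) ≤ p(t)/(c₀|g(t)|) for t < 0 with g(t) ≠ 0,
1 - F(t) ≤ p(t)/(c₀ g(t)) for t > 0 with g(t) ≠ 0, and consequently
|p'(x)| min(F(x), 1-F(x)) ≤ p(x)², where p'(x) = -c₀ g(x) p(x). -/
theorem density_tail_bound_g
    (g : ℝ → ℝ) (c₀ c₁ : ℝ) (hc₀ : 0 < c₀) (hc₁pos : 0 < c₁)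
    -- (H1)
    (hmono : Monotone g) (hgpos : ∀ t, 0 < t → 0 ≤ g t) (hgneg : ∀ t, t ≤ 0 → g t ≤ 0)
    (hpInt : Integrable (fun t => Real.exp (-(c₀ * ∫ s in (0:ℝ)..t, g s))))
    (hc₁ : c₁ = (∫ t : ℝ, Real.exp (-(c₀ * ∫ s in (0:ℝ)..t, g s)))⁻¹) :
    (∀ t : ℝ, t < 0 → g t ≠ 0 →
      (∫ u in Set.Iic t, c₁ * Real.exp (-(c₀ * ∫ s in (0:ℝ)..u, g s)))
        ≤ (c₁ * Real.exp (-(c₀ * ∫ s in (0:ℝ)..t, g s))) / (c₀ * |g t|))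
    ∧ (∀ t : ℝ, 0 < t → g t ≠ 0 →
      1 - (∫ u in Set.Iic t, c₁ * Real.exp (-(c₀ * ∫ s in (0:ℝ)..u, g s)))
        ≤ (c₁ * Real.exp (-(c₀ * ∫ s in (0:ℝ)..t, g s))) / (c₀ * g t))
    ∧ ∀ x : ℝ,
      |-(c₀ * g x) * (c₁ * Real.exp (-(c₀ * ∫ s in (0:ℝ)..x, g s)))|
          * min (∫ u in Set.Iic x, c₁ * Real.exp (-(c₀ * ∫ s in (0:ℝ)..u, g s)))
              (1 - ∫ u in Set.Iic x, c₁ * Real.exp (-(c₀ * ∫ s in (0:ℝ)..u, g s)))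
        ≤ (c₁ * Real.exp (-(c₀ * ∫ s in (0:ℝ)..x, g s))) ^ 2 := by
  set p : ℝ → ℝ := fun u => c₁ * Real.exp (-(c₀ * ∫ s in (0:ℝ)..u, g s)) with hp
  have p_pos (u : ℝ) : 0 < p u := mul_pos hc₁pos (Real.exp_pos _)
  have p_int : Integrable p := hpInt.const_mul c₁
  have p_total : ∫ u, p u = 1 := by
    have hne := hc₁pos.ne'
    rw [hc₁] at hne
    rw [hp, integral_const_mul, hc₁]
    exact inv_mul_cancel₀ (inv_eq_zero.not.mp hne)
  have tail (t : ℝ) : 1 - ∫ u in Set.Iic t, p u = ∫ u in Set.Ioi t, p u := by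
    rw [← p_total, ← setIntegral_compl measurableSet_Iic p_int, Set.compl_Iic]
  have p_le (t u : ℝ) : p u ≤ p t * Real.exp (-(c₀ * g t) * (u - t)) := by
    have key := hmono.mul_sub_le_intervalIntegral t u
    have hadd := intervalIntegral.integral_add_adjacent_intervals
      (hmono.intervalIntegrable (μ := volume) (a := 0) (b := t))
      (hmono.intervalIntegrable (b := u))
    simp only [hp]
    rw [mul_assoc, ← Real.exp_add, ← hadd]
    gcongr
    nlinarith
  have left (t : ℝ) (ht : g t < 0) : ∫ u in Set.Iic t, p u ≤ p t / (c₀ * |g t|) :=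
    setIntegral_Iic_le_div_of_le_mul_exp p_int (mul_pos hc₀ (abs_pos.mpr ht.ne)) fun u => by
      simpa [abs_of_neg ht] using p_le t u
  have right (t : ℝ) (ht : 0 < g t) : 1 - ∫ u in Set.Iic t, p u ≤ p t / (c₀ * g t) :=
    (tail t).trans_le (setIntegral_Ioi_le_div_of_le_mul_exp p_int (mul_pos hc₀ ht) (p_le t))
  refine ⟨fun t ht h => left t ((hgneg t ht.le).lt_of_ne h),
    fun t ht h => right t ((hgpos t ht).lt_of_ne' h), fun x => ?_⟩
  change |-(c₀ * g x) * p x| * min (∫ u in Set.Iic x, p u) (1 - ∫ u in Set.Iic x, p u) ≤ p x ^ 2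
  rw [abs_mul, abs_neg, abs_mul, abs_of_pos hc₀, abs_of_pos (p_pos x)]
  rcases eq_or_ne (g x) 0 with h | h
  · simpa [h] using sq_nonneg (p x)
  have ha : 0 < c₀ * |g x| := mul_pos hc₀ (abs_pos.mpr h)
  have hmin : min (∫ u in Set.Iic x, p u) (1 - ∫ u in Set.Iic x, p u) ≤ p x / (c₀ * |g x|) := by
    rcases h.lt_or_gt with h | h
    · exact (min_le_left _ _).trans (left x h)
    · exact (min_le_right _ _).trans (by simpa only [abs_of_pos h] using right x h)
  calc _ ≤ c₀ * |g x| * p x * (p x / (c₀ * |g x|)) :=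
        mul_le_mul_of_nonneg_left hmin (mul_pos ha (p_pos x)).le
    _ = p x ^ 2 := by field_simp
end

section
/- For every positive integer n and every σ ∈ {−1,1}ⁿ, with m = n⁻¹ Σ_{i=1}^n σ_i, m_i = n⁻¹ Σ_{j≠i} σ_j, and W = n^{−3/4} Σ_{i=1}^n σ_i, one has | n^{−3/4} m − n^{−7/4} Σ_{i=1}^n tanh(m_i) − (n^{−3/2}/3) W³ | ≤ (2 n^{−2}/15) |W|⁵ + n^{−2} |W| + (2/3^{3/2}) n^{−11/4}. -/
open Finset

theorem Real.hasDerivAt_tanh_one_sub_sq (x : ℝ) :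
    HasDerivAt Real.tanh (1 - Real.tanh x ^ 2) x := by
  have hc : Real.cosh x ≠ 0 := (Real.cosh_pos x).ne'
  have h := (Real.hasDerivAt_sinh x).div (Real.hasDerivAt_cosh x) hc
  have hfun : Real.tanh = Real.sinh / Real.cosh := by
    ext y
    rw [Pi.div_apply, Real.tanh_eq_sinh_div_cosh]
  rw [hfun]
  refine h.congr_deriv ?_
  rw [Pi.div_apply]
  field_simp

theorem nonneg_of_hasDerivAt_nonneg {f f' : ℝ → ℝ} (hf : ∀ x, HasDerivAt f (f' x) x)
    (h0 : f 0 = 0) (hf' : ∀ x, 0 ≤ x → 0 ≤ f' x) {x : ℝ} (hx : 0 ≤ x) : 0 ≤ f x := by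
  have hmono : MonotoneOn f (Set.Ici 0) :=
    monotoneOn_of_hasDerivWithinAt_nonneg (convex_Ici 0)
      (fun y _ => (hf y).continuousAt.continuousWithinAt)
      (fun y _ => (hf y).hasDerivWithinAt)
      (fun y hy => hf' y (by rw [interior_Ici] at hy; exact le_of_lt hy))
  have h := hmono Set.self_mem_Ici hx hx
  rwa [h0] at h

theorem Real.tanh_nonneg_of_nonneg {x : ℝ} (hx : 0 ≤ x) : 0 ≤ Real.tanh x :=
  nonneg_of_hasDerivAt_nonneg Real.hasDerivAt_tanh_one_sub_sq Real.tanh_zero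
    (fun y _ => by linarith [Real.tanh_sq_lt_one y]) hx

theorem Real.tanh_le_self_of_nonneg {x : ℝ} (hx : 0 ≤ x) : Real.tanh x ≤ x := by
  have h := nonneg_of_hasDerivAt_nonneg (f := fun y => y - Real.tanh y)
    (fun y => (hasDerivAt_id' y).sub (Real.hasDerivAt_tanh_one_sub_sq y)) (by simp)
    (fun y _ => by nlinarith [sq_nonneg (Real.tanh y)]) hx
  linarith

theorem Real.sub_cube_le_tanh {x : ℝ} (hx : 0 ≤ x) : x - x ^ 3 / 3 ≤ Real.tanh x := by
  have h := nonneg_of_hasDerivAt_nonneg (f := fun y => Real.tanh y - (y - y ^ 3 / 3))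
    (fun y => (Real.hasDerivAt_tanh_one_sub_sq y).sub
      ((hasDerivAt_id' y).sub ((hasDerivAt_pow 3 y).div_const 3))) (by simp)
    (fun y hy => by
      have := pow_le_pow_left₀ (Real.tanh_nonneg_of_nonneg hy) (Real.tanh_le_self_of_nonneg hy) 2
      norm_num
      linarith) hx
  linarith

theorem Real.tanh_le_sub_cube_add {x : ℝ} (hx : 0 ≤ x) :
    Real.tanh x ≤ x - x ^ 3 / 3 + 2 / 15 * x ^ 5 := by
  have h := nonneg_of_hasDerivAt_nonneg
    (f := fun y => y - y ^ 3 / 3 + 2 / 15 * y ^ 5 - Real.tanh y)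
    (fun y => (((hasDerivAt_id' y).sub ((hasDerivAt_pow 3 y).div_const 3)).add
      ((hasDerivAt_pow 5 y).const_mul (2 / 15))).sub (Real.hasDerivAt_tanh_one_sub_sq y)) (by simp)
    (fun y hy => by
      norm_num
      rcases le_total 0 (y - y ^ 3 / 3) with h | h
      · have := pow_le_pow_left₀ h (Real.sub_cube_le_tanh hy) 2
        nlinarith [sq_nonneg (y ^ 3)]
      · have hy2 : y ^ 2 ≤ y ^ 4 / 3 := by nlinarith
        nlinarith [sq_nonneg (Real.tanh y), sq_nonneg (y ^ 2)]) hx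
  linarith

theorem Real.abs_sub_tanh_sub_cube_le (x : ℝ) :
    |x - Real.tanh x - x ^ 3 / 3| ≤ 2 / 15 * |x| ^ 5 := by
  rcases le_total 0 x with hx | hx
  · rw [abs_of_nonneg hx, abs_le]
    constructor <;> nlinarith [Real.sub_cube_le_tanh hx, Real.tanh_le_sub_cube_add hx,
      pow_nonneg hx 5]
  · have hx' : 0 ≤ -x := by linarith
    have h1 := Real.sub_cube_le_tanh hx'
    have h2 := Real.tanh_le_sub_cube_add hx'
    rw [Real.tanh_neg] at h1 h2
    rw [abs_of_nonpos hx, abs_le]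
    constructor <;> nlinarith [pow_nonneg hx' 5]

theorem Real.abs_sub_cube_le {t : ℝ} (ht : |t| ≤ 1) :
    |t * (1 - t ^ 2)| ≤ 2 / 3 ^ ((3 : ℝ) / 2) := by
  have hK : (2 : ℝ) / 3 ^ ((3 : ℝ) / 2) = 2 * (√3 / 3) ^ 3 := by
    have h3 : (3 : ℝ) ^ ((3 : ℝ) / 2) = 3 * √3 := by
      rw [show (3 : ℝ) / 2 = 1 + 1 / 2 by norm_num, Real.rpow_add (by norm_num), Real.rpow_one,
        Real.sqrt_eq_rpow]
    have hs : √3 ^ 2 = (3 : ℝ) := Real.sq_sqrt (by norm_num)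
    have hs0 : √(3 : ℝ) ≠ 0 := by positivity
    rw [h3]
    field_simp
    nlinarith
  have hs : (√3 / 3) ^ 2 = (1 : ℝ) / 3 := by
    rw [div_pow, Real.sq_sqrt (by norm_num)]
    norm_num
  have hs0 : 0 ≤ √3 / (3 : ℝ) := by positivity
  rw [hK]
  generalize √3 / (3 : ℝ) = s at hs hs0
  have hs1 : 1 ≤ 2 * s := by nlinarith
  obtain ⟨h1, h2⟩ := abs_le.mp ht
  have hcube : s ^ 3 = s / 3 := by rw [pow_succ, hs]; ring
  rw [abs_le]
  constructor
  · nlinarith [mul_nonneg (sq_nonneg (t + s)) (by linarith : 0 ≤ 2 * s - t)]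
  · nlinarith [mul_nonneg (sq_nonneg (t - s)) (by linarith : 0 ≤ 2 * s + t)]

theorem Real.tanh_taylor_nonneg (ε x : ℝ) (hε : |ε| = 1) {h : ℝ} (hh : 0 ≤ h) :
    0 ≤ 2 / 3 ^ ((3 : ℝ) / 2) * h ^ 2
      + ε * (Real.tanh (x + h) - Real.tanh x - h * (1 - Real.tanh x ^ 2)) := by
  have hadd (y : ℝ) : HasDerivAt (fun z => Real.tanh (x + z)) (1 - Real.tanh (x + y) ^ 2) y :=
    (Real.hasDerivAt_tanh_one_sub_sq (x + y)).comp_const_add x y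
  set K : ℝ := 2 / 3 ^ ((3 : ℝ) / 2)
  have hder {y : ℝ} (hy : 0 ≤ y) :
      0 ≤ K * (2 * y) + ε * ((1 - Real.tanh (x + y) ^ 2) - (1 - Real.tanh x ^ 2)) := by
    refine nonneg_of_hasDerivAt_nonneg
      (f := fun z => K * (2 * z) + ε * ((1 - Real.tanh (x + z) ^ 2) - (1 - Real.tanh x ^ 2)))
      (fun z => (((hasDerivAt_id' z).const_mul 2).const_mul K).add
        (((((hadd z).pow 2).const_sub 1).sub_const _).const_mul ε)) (by simp) (fun z _ => ?_) hy
    have hb : |ε * (Real.tanh (x + z) * (1 - Real.tanh (x + z) ^ 2))| ≤ K := by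
      rw [abs_mul, hε, one_mul]
      exact Real.abs_sub_cube_le (Real.abs_tanh_lt_one (x + z)).le
    have := (abs_le.mp hb).2
    norm_num
    linarith
  refine nonneg_of_hasDerivAt_nonneg
    (f := fun z => K * z ^ 2 + ε * (Real.tanh (x + z) - Real.tanh x - z * (1 - Real.tanh x ^ 2)))
    (fun z => ((hasDerivAt_pow 2 z).const_mul K).add
      ((((hadd z).sub_const _).sub ((hasDerivAt_id' z).mul_const _)).const_mul ε))
    (by simp) (fun z hz => ?_) hh
  have := hder hz
  norm_num at this ⊢
  linarith

theorem Real.abs_tanh_add_sub_le (x h : ℝ) :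
    |Real.tanh (x + h) - Real.tanh x - h * (1 - Real.tanh x ^ 2)|
      ≤ 2 / 3 ^ ((3 : ℝ) / 2) * h ^ 2 := by
  rw [abs_le]
  rcases le_total 0 h with hh | hh
  · have h1 := Real.tanh_taylor_nonneg 1 x (by simp) hh
    have h2 := Real.tanh_taylor_nonneg (-1) x (by simp) hh
    constructor <;> linarith
  · have hh' : 0 ≤ -h := by linarith
    have h1 := Real.tanh_taylor_nonneg 1 (-x) (by simp) hh'
    have h2 := Real.tanh_taylor_nonneg (-1) (-x) (by simp) hh'
    rw [← neg_add, Real.tanh_neg, Real.tanh_neg, neg_sq, neg_sq] at h1 h2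
    constructor <;> linarith

theorem curieWeiss_tanh_average_estimate {n : ℕ} (hn : 0 < n) (σ : Fin n → ℝ)
    (hσ : ∀ i, σ i = 1 ∨ σ i = -1) :
    |(∑ i, σ i) / n - (∑ i, Real.tanh ((∑ j ∈ univ.erase i, σ j) / n)) / n
        - ((∑ i, σ i) / n) ^ 3 / 3|
      ≤ 2 / 15 * |(∑ i, σ i) / n| ^ 5 + |(∑ i, σ i) / n| / n
        + 2 / 3 ^ ((3 : ℝ) / 2) / (n : ℝ) ^ 2 := by
  have hn' : (0 : ℝ) < n := by exact_mod_cast hn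
  set m : ℝ := (∑ i, σ i) / n with hm
  set t : ℝ := Real.tanh m with ht
  have hmi (i : Fin n) : (∑ j ∈ univ.erase i, σ j) / n = m + -(σ i / n) := by
    rw [hm, ← Finset.add_sum_erase univ σ (Finset.mem_univ i)]
    ring
  have hbound (i : Fin n) :
      |Real.tanh ((∑ j ∈ univ.erase i, σ j) / n) - t + σ i / n * (1 - t ^ 2)|
        ≤ 2 / 3 ^ ((3 : ℝ) / 2) / (n : ℝ) ^ 2 := by
    have h := Real.abs_tanh_add_sub_le m (-(σ i / n))
    have hsq : σ i ^ 2 = 1 := by rcases hσ i with h | h <;> rw [h] <;> norm_num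
    rw [← hmi, neg_sq, div_pow, hsq, neg_mul, sub_neg_eq_add, mul_one_div] at h
    exact h
  have hsum : |∑ i, (Real.tanh ((∑ j ∈ univ.erase i, σ j) / n) - t + σ i / n * (1 - t ^ 2))|
      ≤ n * (2 / 3 ^ ((3 : ℝ) / 2) / (n : ℝ) ^ 2) := by
    refine (Finset.abs_sum_le_sum_abs _ _).trans ((Finset.sum_le_sum fun i _ => hbound i).trans ?_)
    simp
  rw [Finset.sum_add_distrib, Finset.sum_sub_distrib, ← Finset.sum_mul, ← Finset.sum_div, ← hm,
    Finset.sum_const, Finset.card_univ, Fintype.card_fin, nsmul_eq_mul] at hsum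
  set A : ℝ := ∑ i, Real.tanh ((∑ j ∈ univ.erase i, σ j) / n)
  have havg : |A / n - t + m * (1 - t ^ 2) / n| ≤ 2 / 3 ^ ((3 : ℝ) / 2) / (n : ℝ) ^ 2 := by
    have heq : A - n * t + m * (1 - t ^ 2) = n * (A / n - t + m * (1 - t ^ 2) / n) := by
      field_simp
    rw [heq, abs_mul, abs_of_pos hn'] at hsum
    exact le_of_mul_le_mul_left hsum hn'
  have hlin : |m * (1 - t ^ 2) / n| ≤ |m| / n := by
    rw [abs_div, abs_mul, abs_of_pos hn']
    gcongr
    refine mul_le_of_le_one_right (abs_nonneg m) ?_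
    rw [abs_of_nonneg (by linarith [Real.tanh_sq_lt_one m])]
    linarith [sq_nonneg t]
  have htay := Real.abs_sub_tanh_sub_cube_le m
  rw [← ht] at htay
  rw [abs_le] at *
  constructor <;> linarith [havg.1, havg.2, hlin.1, hlin.2, htay.1, htay.2]

/-- **Deterministic drift estimate for the critical Curie–Weiss model** (part of Lemma 5.1):
for any spin configuration σ ∈ {-1,1}ⁿ, with m = n⁻¹Σσᵢ, mᵢ = n⁻¹Σ_{j≠i}σⱼ and
W = n^{-3/4}Σσᵢ,
|n^{-3/4} m - n^{-7/4} Σ tanh(mᵢ) - (n^{-3/2}/3) W³|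
  ≤ (2n^{-2}/15)|W|⁵ + n^{-2}|W| + (2/3^{3/2}) n^{-11/4}. -/
theorem curieWeiss_drift_estimate
    (n : ℕ) (hn : 0 < n) (σ : Fin n → ℝ) (hσ : ∀ i, σ i = 1 ∨ σ i = -1) :
    |(n : ℝ) ^ (-(3 : ℝ) / 4) * ((∑ i : Fin n, σ i) / n)
        - (n : ℝ) ^ (-(7 : ℝ) / 4)
            * ∑ i : Fin n, Real.tanh ((∑ j ∈ Finset.univ.erase i, σ j) / n)
        - (n : ℝ) ^ (-(3 : ℝ) / 2) / 3
            * ((n : ℝ) ^ (-(3 : ℝ) / 4) * ∑ i : Fin n, σ i) ^ 3|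
      ≤ 2 * (n : ℝ) ^ (-(2 : ℝ)) / 15
            * |(n : ℝ) ^ (-(3 : ℝ) / 4) * ∑ i : Fin n, σ i| ^ 5
        + (n : ℝ) ^ (-(2 : ℝ)) * |(n : ℝ) ^ (-(3 : ℝ) / 4) * ∑ i : Fin n, σ i|
        + 2 / 3 ^ ((3 : ℝ) / 2) * (n : ℝ) ^ (-(11 : ℝ) / 4) := by
  have hn' : (0 : ℝ) < n := by exact_mod_cast hn
  have key := curieWeiss_tanh_average_estimate hn σ hσ
  set S : ℝ := ∑ i : Fin n, σ i
  set A : ℝ := ∑ i : Fin n, Real.tanh ((∑ j ∈ univ.erase i, σ j) / n)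
  set K : ℝ := 2 / 3 ^ ((3 : ℝ) / 2)
  obtain ⟨c, hc, hcn⟩ : ∃ c : ℝ, 0 < c ∧ c ^ 4 = n :=
    ⟨(n : ℝ) ^ ((1 : ℝ) / 4), by positivity, by
      rw [← Real.rpow_natCast, ← Real.rpow_mul hn'.le]
      norm_num⟩
  have hpow (k : ℕ) (x : ℝ) (hx : x = -(k : ℝ) / 4) : (n : ℝ) ^ x = (c ^ k)⁻¹ := by
    rw [← hcn, ← Real.rpow_natCast c 4, ← Real.rpow_mul hc.le, hx, ← Real.rpow_natCast c k,
      ← Real.rpow_neg hc.le]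
    congr 1
    push_cast
    ring
  rw [hpow 3 (-3 / 4) (by norm_num), hpow 7 (-7 / 4) (by norm_num),
    hpow 6 (-3 / 2) (by norm_num), hpow 8 (-2) (by norm_num), hpow 11 (-11 / 4) (by norm_num)]
  rw [← hcn] at key ⊢
  have hlhs : (c ^ 3)⁻¹ * (S / c ^ 4) - (c ^ 7)⁻¹ * A - (c ^ 6)⁻¹ / 3 * ((c ^ 3)⁻¹ * S) ^ 3
      = (c ^ 3)⁻¹ * (S / c ^ 4 - A / c ^ 4 - (S / c ^ 4) ^ 3 / 3) := by
    field_simp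
  have hrhs : 2 * (c ^ 8)⁻¹ / 15 * |(c ^ 3)⁻¹ * S| ^ 5 + (c ^ 8)⁻¹ * |(c ^ 3)⁻¹ * S|
        + K * (c ^ 11)⁻¹
      = (c ^ 3)⁻¹ * (2 / 15 * |S / c ^ 4| ^ 5 + |S / c ^ 4| / c ^ 4 + K / (c ^ 4) ^ 2) := by
    rw [abs_mul, abs_div, abs_of_pos (by positivity : 0 < (c ^ 3)⁻¹),
      abs_of_pos (by positivity : 0 < c ^ 4)]
    field_simp
  rw [hlhs, hrhs, abs_mul, abs_of_pos (by positivity : 0 < (c ^ 3)⁻¹)]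
  exact mul_le_mul_of_nonneg_left key (by positivity)
end

section
/- For every positive integer n and every σ ∈ {−1,1}ⁿ, with m = n⁻¹ Σ_{i=1}^n σ_i, m_i = n⁻¹ Σ_{j≠i} σ_j, and W = n^{−3/4} Σ_{i=1}^n σ_i, one has 2 n^{−5/2} | Σ_{i=1}^n σ_i tanh(m_i) | ≤ 2 n^{−5/2} + 2 n^{−2} W². -/
open Finset

theorem Real.abs_tanh_sub_tanh_le (x y : ℝ) : |Real.tanh x - Real.tanh y| ≤ |x - y| := by
  have hderiv : ∀ t : ℝ, HasDerivAt Real.tanh (1 / Real.cosh t ^ 2) t := fun t => by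
    have h := (Real.hasDerivAt_sinh t).div (Real.hasDerivAt_cosh t) (Real.cosh_pos t).ne'
    have hq : Real.sinh / Real.cosh = Real.tanh :=
      funext fun s => (Real.tanh_eq_sinh_div_cosh s).symm
    rwa [hq, ← sq, ← sq, Real.cosh_sq_sub_sinh_sq] at h
  have hbound : ∀ t ∈ Set.univ, ‖1 / Real.cosh t ^ 2‖ ≤ 1 := fun t _ => by
    rw [Real.norm_of_nonneg (by positivity)]
    exact div_le_one_of_le₀ (one_le_pow₀ (Real.one_le_cosh t)) (by positivity)
  simpa using convex_univ.norm_image_sub_le_of_norm_hasDerivWithin_le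
    (fun t _ => (hderiv t).hasDerivWithinAt) hbound (Set.mem_univ y) (Set.mem_univ x)

theorem abs_sum_spin_mul_tanh_le (n : ℕ) (hn : 0 < n) (σ : Fin n → ℝ)
    (hσ : ∀ i, σ i = 1 ∨ σ i = -1) :
    |∑ i : Fin n, σ i * Real.tanh ((∑ j ∈ Finset.univ.erase i, σ j) / n)|
      ≤ 1 + (∑ i : Fin n, σ i) ^ 2 / n := by
  have hn' : (0 : ℝ) < n := by exact_mod_cast hn
  have habs : ∀ i, |σ i| = 1 := fun i => by rcases hσ i with h | h <;> simp [h]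
  set S := ∑ i : Fin n, σ i with hS
  have hterm : ∀ i ∈ Finset.univ, |σ i * (Real.tanh ((∑ j ∈ Finset.univ.erase i, σ j) / n)
      - Real.tanh (S / n))| ≤ 1 / n := fun i _ => by
    rw [abs_mul, habs, one_mul]
    refine (Real.abs_tanh_sub_tanh_le _ _).trans_eq ?_
    rw [← sub_div, Finset.sum_erase_eq_sub (Finset.mem_univ i), ← hS, sub_sub_cancel_left,
      abs_div, abs_neg, habs, Nat.abs_cast]
  have hflip : |∑ i : Fin n, σ i * (Real.tanh ((∑ j ∈ Finset.univ.erase i, σ j) / n)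
      - Real.tanh (S / n))| ≤ 1 := by
    refine (Finset.abs_sum_le_sum_abs _ _).trans ((Finset.sum_le_sum hterm).trans_eq ?_)
    simp [hn'.ne']
  have hmean : |S * Real.tanh (S / n)| ≤ S ^ 2 / n := by
    have h : |Real.tanh (S / n)| ≤ |S / n| := by
      simpa using Real.abs_tanh_sub_tanh_le (S / n) 0
    calc |S * Real.tanh (S / n)| = |S| * |Real.tanh (S / n)| := abs_mul _ _
      _ ≤ |S| * |S / n| := by gcongr
      _ = S ^ 2 / n := by rw [abs_div, Nat.abs_cast, ← mul_div_assoc, abs_mul_abs_self, sq]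
  have hsplit : ∑ i : Fin n, σ i * Real.tanh ((∑ j ∈ Finset.univ.erase i, σ j) / n)
      = ∑ i : Fin n, σ i * (Real.tanh ((∑ j ∈ Finset.univ.erase i, σ j) / n)
        - Real.tanh (S / n)) + S * Real.tanh (S / n) := by
    simp only [mul_sub, Finset.sum_sub_distrib, ← Finset.sum_mul, ← hS, sub_add_cancel]
  rw [hsplit]
  exact (abs_add_le _ _).trans (add_le_add hflip hmean)

/-- **Deterministic quadratic-variation estimate for the critical Curie–Weiss model**
(part of Lemma 5.1): for any spin configuration σ ∈ {-1,1}ⁿ, with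
mᵢ = n⁻¹Σ_{j≠i}σⱼ and W = n^{-3/4}Σσᵢ,
2 n^{-5/2} |Σ σᵢ tanh(mᵢ)| ≤ 2 n^{-5/2} + 2 n^{-2} W². -/
theorem curieWeiss_quadratic_variation_estimate
    (n : ℕ) (hn : 0 < n) (σ : Fin n → ℝ) (hσ : ∀ i, σ i = 1 ∨ σ i = -1) :
    2 * (n : ℝ) ^ (-(5 : ℝ) / 2)
        * |∑ i : Fin n, σ i * Real.tanh ((∑ j ∈ Finset.univ.erase i, σ j) / n)|
      ≤ 2 * (n : ℝ) ^ (-(5 : ℝ) / 2)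
        + 2 * (n : ℝ) ^ (-(2 : ℝ))
            * ((n : ℝ) ^ (-(3 : ℝ) / 4) * ∑ i : Fin n, σ i) ^ 2 := by
  have hn' : (0 : ℝ) < n := by exact_mod_cast hn
  have hpow : (n : ℝ) ^ (-(2 : ℝ)) * ((n : ℝ) ^ (-(3 : ℝ) / 4)) ^ 2
      = (n : ℝ) ^ (-(5 : ℝ) / 2) / n := by
    rw [← Real.rpow_mul_natCast hn'.le, ← Real.rpow_add hn', ← Real.rpow_sub_one hn'.ne']
    norm_num
  calc _ ≤ 2 * (n : ℝ) ^ (-(5 : ℝ) / 2) * (1 + (∑ i : Fin n, σ i) ^ 2 / n) := by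
        gcongr
        exact abs_sum_spin_mul_tanh_le n hn σ hσ
    _ = _ := by
        linear_combination -2 * (∑ i : Fin n, σ i) ^ 2 * hpow
end

section
/- For every positive integer n, under the Curie-Weiss measure at critical temperature T = 1 on {−1,1}ⁿ, the random variable W(σ) = n^{−3/4} Σ_{i=1}^n σ_i satisfies E(W⁶) ≤ 224.4, and consequently E|W|³ ≤ 15. -/
open MeasureTheory Finset

/-- The value in `{-1, 1}` of a spin encoded by a Boolean. -/
noncomputable def spin (b : Bool) : ℝ := if b then 1 else -1

lemma spin_not (b : Bool) : spin (!b) = -spin b := by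
  cases b <;> simp [spin]

lemma spin_sq (b : Bool) : spin b ^ 2 = 1 := by
  cases b <;> simp [spin]

lemma abs_spin (b : Bool) : |spin b| = 1 := by
  cases b <;> simp [spin]

/-- The total magnetization of a configuration. -/
noncomputable def magnetization {n : ℕ} (σ : Fin n → Bool) : ℝ := ∑ i, spin (σ i)

lemma abs_magnetization_le {n : ℕ} (σ : Fin n → Bool) : |magnetization σ| ≤ n := by
  refine (abs_sum_le_sum_abs _ _).trans ?_
  simp [abs_spin]

lemma abs_magnetization_sub_spin_le {n : ℕ} (σ : Fin n → Bool) (i : Fin n) :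
    |magnetization σ - spin (σ i)| ≤ n := by
  have h : magnetization σ - spin (σ i) = ∑ j ∈ univ.erase i, spin (σ j) :=
    (sum_erase_eq_sub (mem_univ i)).symm
  rw [h]
  refine (abs_sum_le_sum_abs _ _).trans ?_
  simp only [abs_spin, sum_const, nsmul_eq_mul, mul_one]
  exact_mod_cast (card_le_univ _).trans (by simp)

lemma magnetization_flip {n : ℕ} (σ : Fin n → Bool) (i : Fin n) :
    magnetization (Function.update σ i (!σ i)) = magnetization σ - 2 * spin (σ i) := by
  have h : ∀ τ : Fin n → Bool, magnetization τ = spin (τ i) + ∑ j ∈ univ.erase i, spin (τ j) :=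
    fun τ => (add_sum_erase _ _ (mem_univ i)).symm
  rw [h, h σ, Function.update_self, spin_not]
  have : ∑ j ∈ univ.erase i, spin (Function.update σ i (!σ i) j)
      = ∑ j ∈ univ.erase i, spin (σ j) :=
    sum_congr rfl fun j hj => by rw [Function.update_of_ne (ne_of_mem_erase hj)]
  rw [this]
  ring

lemma sum_lt_mul_eq {n : ℕ} (s : Fin n → ℝ) (hs : ∀ i, s i ^ 2 = 1) :
    ∑ i, ∑ j ∈ univ.filter (fun j => i < j), s i * s j = ((∑ i, s i) ^ 2 - n) / 2 := by
  have hsplit : ∀ i j : Fin n, s i * s j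
      = ((if i < j then s i * s j else 0) + (if j < i then s i * s j else 0))
        + (if i = j then s i * s j else 0) := by
    intro i j
    rcases lt_trichotomy i j with h | h | h
    · simp [h, h.not_gt, h.ne]
    · simp [h]
    · simp [h, h.not_gt, h.ne']
  have hsymm : ∑ i, ∑ j, (if j < i then s i * s j else 0)
      = ∑ i, ∑ j, (if i < j then s i * s j else 0) := by
    rw [sum_comm]
    simp only [mul_comm]
  have hdiag : ∑ i, ∑ j, (if i = j then s i * s j else 0) = (n : ℝ) := by
    simp [← sq, hs]
  have hsq : (∑ i, s i) ^ 2 = ∑ i, ∑ j, s i * s j := by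
    rw [sq, sum_mul_sum]
  have : ∑ i, ∑ j, s i * s j = 2 * (∑ i, ∑ j, if i < j then s i * s j else 0) + n := by
    rw [sum_congr rfl fun i _ => sum_congr rfl fun j _ => hsplit i j]
    simp only [sum_add_distrib]
    rw [hsymm, hdiag]
    ring
  simp only [sum_filter]
  rw [hsq, this]
  ring

/-- The unnormalized Gibbs weight of the Curie–Weiss model at critical temperature. -/
noncomputable def gibbsWeight {n : ℕ} (σ : Fin n → Bool) : ℝ :=
  Real.exp ((1 / (n : ℝ)) * ((magnetization σ ^ 2 - n) / 2))

lemma sum_gibbsWeight_mul_spin_sub_tanh {n : ℕ} (i : Fin n) (h : ℝ → ℝ) :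
    ∑ σ : Fin n → Bool, gibbsWeight σ *
      ((spin (σ i) - Real.tanh ((magnetization σ - spin (σ i)) / n))
        * h (magnetization σ - spin (σ i))) = 0 := by
  have hn : (n : ℝ) ≠ 0 := by
    have := i.pos
    positivity
  have hw : ∀ τ : Fin n → Bool, gibbsWeight τ =
      Real.exp ((1 / (n : ℝ)) * (((magnetization τ - spin (τ i)) ^ 2 + 1 - n) / 2))
        * Real.exp (spin (τ i) * ((magnetization τ - spin (τ i)) / n)) := by
    intro τ
    rw [← Real.exp_add, gibbsWeight]
    congr 1
    field_simp
    linear_combination spin_sq (τ i)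
  refine sum_involution (fun σ _ => Function.update σ i (!σ i)) ?_ ?_ ?_ ?_
  · intro σ _
    rw [hw, hw (Function.update σ i (!σ i)), magnetization_flip, Function.update_self, spin_not]
    have hT : magnetization σ - 2 * spin (σ i) - -spin (σ i) = magnetization σ - spin (σ i) := by
      ring
    rw [hT]
    generalize (magnetization σ - spin (σ i)) = T
    set x := T / n
    have hcosh := (Real.cosh_pos x).ne'
    have key : Real.exp (spin (σ i) * x) * (spin (σ i) - Real.tanh x)
        + Real.exp (-spin (σ i) * x) * (-spin (σ i) - Real.tanh x) = 0 := by
      rw [Real.tanh_eq_sinh_div_cosh]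
      cases σ i <;> simp only [spin] <;> simp <;> field_simp <;>
        rw [Real.cosh_eq, Real.sinh_eq] <;> ring
    linear_combination Real.exp ((1 / (n : ℝ)) * ((T ^ 2 + 1 - n) / 2)) * h T * key
  · intro σ _ _ heq
    have := congrFun heq i
    simp at this
  · intro σ _
    exact mem_univ _
  · intro σ _
    simp

lemma cube_div_three_le_mul_cosh_sub_sinh {x : ℝ} (hx : 0 ≤ x) :
    x ^ 3 / 3 ≤ x * Real.cosh x - Real.sinh x := by
  have hd : ∀ y : ℝ, HasDerivAt (fun y => y * Real.cosh y - Real.sinh y - y ^ 3 / 3)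
      (y * (Real.sinh y - y)) y := by
    intro y
    have := (((hasDerivAt_id y).mul (Real.hasDerivAt_cosh y)).sub (Real.hasDerivAt_sinh y)).sub
      ((hasDerivAt_pow 3 y).div_const 3)
    refine HasDerivAt.congr_deriv this ?_
    simp
    ring
  have hmono : MonotoneOn (fun y => y * Real.cosh y - Real.sinh y - y ^ 3 / 3) (Set.Ici 0) := by
    refine monotoneOn_of_hasDerivWithinAt_nonneg (f' := fun y => y * (Real.sinh y - y))
      (convex_Ici 0) (fun y _ => (hd y).continuousAt.continuousWithinAt)
      (fun y _ => (hd y).hasDerivWithinAt) ?_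
    intro y hy
    rw [interior_Ici] at hy
    have hy' : 0 ≤ y := le_of_lt hy
    exact mul_nonneg hy' (sub_nonneg.2 (Real.self_le_sinh_iff.2 hy'))
  have := hmono (Set.mem_Ici.2 le_rfl) (Set.mem_Ici.2 hx) hx
  simp at this
  linarith

lemma cosh_le_five_thirds {x : ℝ} (hx : |x| ≤ 1) : Real.cosh x ≤ 5 / 3 := by
  have h1 : Real.cosh x ≤ Real.cosh 1 := Real.cosh_le_cosh.2 (by simpa using hx)
  have h2 := Real.exp_one_lt_d9
  have h3 := Real.exp_neg_one_lt_d9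
  rw [Real.cosh_eq 1] at h1
  linarith

lemma tanh_le_sub_cube {x : ℝ} (hx : 0 ≤ x) (hx1 : x ≤ 1) : Real.tanh x ≤ x - x ^ 3 / 5 := by
  have h1 := cube_div_three_le_mul_cosh_sub_sinh hx
  have h2 := cosh_le_five_thirds (abs_le.2 ⟨by linarith, hx1⟩)
  rw [Real.tanh_eq_sinh_div_cosh, div_le_iff₀ (Real.cosh_pos x)]
  nlinarith [mul_le_mul_of_nonneg_left h2 (pow_nonneg hx 3)]

lemma tanh_mul_cube_le {x : ℝ} (hx : |x| ≤ 1) :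
    Real.tanh x * x ^ 3 ≤ x ^ 4 - x ^ 6 / 5 := by
  have key : ∀ y : ℝ, 0 ≤ y → y ≤ 1 → Real.tanh y * y ^ 3 ≤ y ^ 4 - y ^ 6 / 5 := by
    intro y h0 h1
    have := mul_le_mul_of_nonneg_right (tanh_le_sub_cube h0 h1) (pow_nonneg h0 3)
    linarith
  rcases le_total 0 x with h | h
  · exact key x h (abs_le.1 hx).2
  · have := key (-x) (by linarith) (by linarith [(abs_le.1 hx).1])
    rw [Real.tanh_neg] at this
    nlinarith

lemma tanh_div_mul_cube_le {n T : ℝ} (hn : 0 < n) (hT : |T| ≤ n) :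
    Real.tanh (T / n) * T ^ 3 ≤ T ^ 4 / n - T ^ 6 / (5 * n ^ 3) := by
  have h := tanh_mul_cube_le (x := T / n) (by rwa [abs_div, abs_of_pos hn, div_le_one hn])
  have := mul_le_mul_of_nonneg_right h (pow_pos hn 3).le
  have e1 : Real.tanh (T / n) * (T / n) ^ 3 * n ^ 3 = Real.tanh (T / n) * T ^ 3 := by
    field_simp
  have e2 : ((T / n) ^ 4 - (T / n) ^ 6 / 5) * n ^ 3 = T ^ 4 / n - T ^ 6 / (5 * n ^ 3) := by
    field_simp
  linarith

lemma sum_spin_sub_tanh_mul_cube_ge {n : ℕ} (hn : 6 ≤ n) (σ : Fin n → Bool) :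
    (n - 6) * magnetization σ ^ 6 / (5 * n ^ 3) - (3 * n + 3) * magnetization σ ^ 2 - (n + 1)
      ≤ ∑ i, (spin (σ i) - Real.tanh ((magnetization σ - spin (σ i)) / n))
        * (magnetization σ - spin (σ i)) ^ 3 := by
  have hn' : (6 : ℝ) ≤ n := by exact_mod_cast hn
  have hn0 : (0 : ℝ) < n := by linarith
  set S := magnetization σ with hS
  have hsum : ∑ i, spin (σ i) = S := rfl
  have hterm : ∀ i, (S ^ 3 * spin (σ i) - 3 * S ^ 2 + 3 * S * spin (σ i) - 1)
      - (S ^ 4 - 4 * S ^ 3 * spin (σ i) + 6 * S ^ 2 - 4 * S * spin (σ i) + 1) / n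
      + (S ^ 6 - 6 * S ^ 5 * spin (σ i) + 15 * S ^ 4 - 20 * S ^ 3 * spin (σ i) + 15 * S ^ 2
          - 6 * S * spin (σ i) + 1) / (5 * n ^ 3)
      ≤ (spin (σ i) - Real.tanh ((S - spin (σ i)) / n)) * (S - spin (σ i)) ^ 3 := by
    intro i
    have h := tanh_div_mul_cube_le hn0 (abs_magnetization_sub_spin_le σ i)
    rw [← hS] at h
    have e1 : S ^ 3 * spin (σ i) - 3 * S ^ 2 + 3 * S * spin (σ i) - 1
        = spin (σ i) * (S - spin (σ i)) ^ 3 := by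
      cases σ i <;> simp [spin] <;> ring
    have e2 : S ^ 4 - 4 * S ^ 3 * spin (σ i) + 6 * S ^ 2 - 4 * S * spin (σ i) + 1
        = (S - spin (σ i)) ^ 4 := by
      cases σ i <;> simp [spin] <;> ring
    have e3 : S ^ 6 - 6 * S ^ 5 * spin (σ i) + 15 * S ^ 4 - 20 * S ^ 3 * spin (σ i) + 15 * S ^ 2
        - 6 * S * spin (σ i) + 1 = (S - spin (σ i)) ^ 6 := by
      cases σ i <;> simp [spin] <;> ring
    rw [e1, e2, e3]
    linarith
  refine le_trans ?_ (sum_le_sum fun i _ => hterm i)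
  simp only [sum_add_distrib, sum_sub_distrib, ← sum_div, ← mul_sum, hsum, sum_const, card_univ,
    Fintype.card_fin, nsmul_eq_mul]
  have e : (S ^ 3 * S - 3 * (n * S ^ 2) + 3 * S * S - n * 1)
      - (n * S ^ 4 - 4 * S ^ 3 * S + 6 * (n * S ^ 2) - 4 * S * S + n * 1) / n
      + (n * S ^ 6 - 6 * S ^ 5 * S + 15 * (n * S ^ 4) - 20 * S ^ 3 * S + 15 * (n * S ^ 2)
          - 6 * S * S + n * 1) / (5 * n ^ 3)
      - ((n - 6) * S ^ 6 / (5 * n ^ 3) - (3 * n + 3) * S ^ 2 - (n + 1))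
      = 4 * S ^ 4 / n + 4 * S ^ 2 / n
        + ((15 * n - 20) * S ^ 4 + (15 * n - 6) * S ^ 2 + n) / (5 * n ^ 3) := by
    field_simp
    ring
  have h1 : 0 ≤ (15 * (n : ℝ) - 20) * S ^ 4 := mul_nonneg (by linarith) (by positivity)
  have h2 : 0 ≤ (15 * (n : ℝ) - 6) * S ^ 2 := mul_nonneg (by linarith) (by positivity)
  have h3 : 0 ≤ 4 * S ^ 4 / n + 4 * S ^ 2 / n
        + ((15 * n - 20) * S ^ 4 + (15 * n - 6) * S ^ 2 + n) / (5 * n ^ 3) := by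
    positivity
  linarith

lemma le_cube_div_add_four {u : ℝ} (hu : 0 ≤ u) : u ≤ u ^ 3 / 100 + 4 := by
  nlinarith [mul_nonneg hu (sq_nonneg (u - 5.8)), sq_nonneg (u - 5.8)]

lemma rescaled_polynomial_ge {n r u : ℝ} (hn : 37 ≤ n) (hr : 0 ≤ r) (hrn : r ^ 2 = n)
    (hu : 0 ≤ u) :
    n * r * (n / 10) * (u ^ 3 - 224.4)
      ≤ (n - 6) * (n * r * u) ^ 3 / (5 * n ^ 3) - (3 * n + 3) * (n * r * u) - (n + 1) := by
  have hn0 : n ≠ 0 := by linarith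
  have hr6 : 6 ≤ r := by nlinarith
  have e : (n - 6) * (n * r * u) ^ 3 / (5 * n ^ 3) = n * r * ((n - 6) * u ^ 3 / 5) := by
    field_simp
    linear_combination (n - 6) * u ^ 3 * hrn
  have h1 : n + 1 ≤ n * r * 1 := by nlinarith
  have hu3 : 0 ≤ u ^ 3 := by positivity
  have h2 : n / 10 * (u ^ 3 - 224.4) ≤ (n - 6) * u ^ 3 / 5 - (3 * n + 3) * u - 1 := by
    have := mul_le_mul_of_nonneg_left (le_cube_div_add_four hu) (by linarith : 0 ≤ 3 * n + 3)
    have h3 : 0 ≤ (7 * n - 123) * u ^ 3 := mul_nonneg (by linarith) hu3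
    nlinarith
  have h4 := mul_le_mul_of_nonneg_left h2 (by positivity : 0 ≤ n * r)
  rw [e]
  linarith

lemma rpow_scaling_sq {n : ℝ} (hn : 0 < n) (S : ℝ) :
    S ^ 2 = n * √n * (n ^ (-(3 : ℝ) / 4) * S) ^ 2 := by
  have h : n * √n * (n ^ (-(3 : ℝ) / 4)) ^ 2 = 1 := by
    rw [Real.sqrt_eq_rpow, ← Real.rpow_natCast, ← Real.rpow_mul hn.le]
    nth_rewrite 1 [← Real.rpow_one n]
    rw [← Real.rpow_add hn, ← Real.rpow_add hn]
    norm_num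
  linear_combination (-S ^ 2) * h

lemma sum_gibbsWeight_mul_pow_six_le {n : ℕ} (hn : 0 < n) :
    ∑ σ : Fin n → Bool, gibbsWeight σ * ((n : ℝ) ^ (-(3 : ℝ) / 4) * magnetization σ) ^ 6
      ≤ 224.4 * ∑ σ : Fin n → Bool, gibbsWeight σ := by
  have hn0 : (0 : ℝ) < n := by exact_mod_cast hn
  have hr := Real.sqrt_nonneg (n : ℝ)
  have hrn : √(n : ℝ) ^ 2 = n := Real.sq_sqrt hn0.le
  have hw : ∀ σ : Fin n → Bool, 0 < gibbsWeight σ := fun σ => Real.exp_pos _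
  rcases le_or_gt n 36 with hsmall | hlarge
  · rw [mul_sum]
    refine sum_le_sum fun σ _ => ?_
    rw [mul_comm (224.4 : ℝ)]
    refine mul_le_mul_of_nonneg_left ?_ (hw σ).le
    have h36 : (n : ℝ) ≤ 36 := by exact_mod_cast hsmall
    have hr6 : √(n : ℝ) ≤ 6 := by nlinarith
    have hr0 : 0 < √(n : ℝ) := Real.sqrt_pos.2 hn0
    have hS : magnetization σ ^ 2 ≤ (n : ℝ) ^ 2 := sq_le_sq.2 (by
      simpa using abs_magnetization_le σ)
    rw [rpow_scaling_sq hn0 (magnetization σ)] at hS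
    set u := ((n : ℝ) ^ (-(3 : ℝ) / 4) * magnetization σ) ^ 2 with hu
    have hur : u ≤ 6 := by
      have : n * √(n : ℝ) * u ≤ n * √(n : ℝ) * √(n : ℝ) := by nlinarith
      exact (le_of_mul_le_mul_left this (by positivity)).trans hr6
    have hu3 : u ^ 3 ≤ 6 ^ 3 := pow_le_pow_left₀ (sq_nonneg _) hur 3
    calc ((n : ℝ) ^ (-(3 : ℝ) / 4) * magnetization σ) ^ 6 = u ^ 3 := by rw [hu]; ring
      _ ≤ 224.4 := hu3.trans (by norm_num)
  · have h37 : (37 : ℝ) ≤ n := by exact_mod_cast hlarge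
    have hpt : ∀ σ : Fin n → Bool, gibbsWeight σ * (n * √(n : ℝ) * (n / 10)
          * (((n : ℝ) ^ (-(3 : ℝ) / 4) * magnetization σ) ^ 6 - 224.4))
        ≤ gibbsWeight σ * ∑ i, (spin (σ i) - Real.tanh ((magnetization σ - spin (σ i)) / n))
          * (magnetization σ - spin (σ i)) ^ 3 := by
      intro σ
      refine mul_le_mul_of_nonneg_left
        (le_trans ?_ (sum_spin_sub_tanh_mul_cube_ge (by omega) σ)) (hw σ).le
      have h := rescaled_polynomial_ge h37 hr hrn
        (sq_nonneg ((n : ℝ) ^ (-(3 : ℝ) / 4) * magnetization σ))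
      rw [← rpow_scaling_sq hn0 (magnetization σ)] at h
      simpa only [← pow_mul] using h
    have hzero : ∑ σ : Fin n → Bool, gibbsWeight σ *
        ∑ i, (spin (σ i) - Real.tanh ((magnetization σ - spin (σ i)) / n))
          * (magnetization σ - spin (σ i)) ^ 3 = 0 := by
      simp only [mul_sum]
      rw [sum_comm]
      exact sum_eq_zero fun i _ => sum_gibbsWeight_mul_spin_sub_tanh i fun t => t ^ 3
    have h := (sum_le_sum fun σ _ => hpt σ).trans hzero.le
    simp only [mul_left_comm (gibbsWeight _), ← mul_sum, mul_sub, sum_sub_distrib,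
      ← sum_mul] at h
    rw [← mul_sub] at h
    have hc : 0 < n * √(n : ℝ) * (n / 10) := by
      have := Real.sqrt_pos.2 hn0
      positivity
    have := nonpos_of_mul_nonpos_right h hc
    linarith

open MeasureTheory Finset

open scoped Classical in
/-- **Moment bounds for the critical Curie–Weiss magnetization** (Lemma 5.1, moment part):
under the Curie–Weiss measure at the critical temperature T = 1 on {-1,1}ⁿ, the random
variable W(σ) = n^{-3/4} Σ σᵢ satisfies E(W⁶) ≤ 224.4 and E|W|³ ≤ 15. Spins are encoded by
σ : Fin n → Bool, with spin value `if σ i then 1 else -1`. -/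
theorem curieWeiss_critical_moment_bounds (n : ℕ) (hn : 0 < n) :
    (∑ σ : Fin n → Bool,
        Real.exp ((1 / (n : ℝ)) * ∑ i : Fin n,
            ∑ j ∈ Finset.univ.filter (fun j : Fin n => i < j),
              (if σ i then (1 : ℝ) else -1) * (if σ j then (1 : ℝ) else -1))
          * ((n : ℝ) ^ (-(3 : ℝ) / 4)
              * (∑ i : Fin n, (if σ i then (1 : ℝ) else -1))) ^ 6)
      / (∑ σ : Fin n → Bool,
          Real.exp ((1 / (n : ℝ)) * ∑ i : Fin n,
            ∑ j ∈ Finset.univ.filter (fun j : Fin n => i < j),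
              (if σ i then (1 : ℝ) else -1) * (if σ j then (1 : ℝ) else -1)))
      ≤ 224.4
    ∧
    (∑ σ : Fin n → Bool,
        Real.exp ((1 / (n : ℝ)) * ∑ i : Fin n,
            ∑ j ∈ Finset.univ.filter (fun j : Fin n => i < j),
              (if σ i then (1 : ℝ) else -1) * (if σ j then (1 : ℝ) else -1))
          * |(n : ℝ) ^ (-(3 : ℝ) / 4)
              * (∑ i : Fin n, (if σ i then (1 : ℝ) else -1))| ^ 3)
      / (∑ σ : Fin n → Bool,
          Real.exp ((1 / (n : ℝ)) * ∑ i : Fin n,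
            ∑ j ∈ Finset.univ.filter (fun j : Fin n => i < j),
              (if σ i then (1 : ℝ) else -1) * (if σ j then (1 : ℝ) else -1)))
      ≤ 15 := by
  have hw : ∀ σ : Fin n → Bool, Real.exp ((1 / (n : ℝ)) * ∑ i : Fin n,
      ∑ j ∈ Finset.univ.filter (fun j : Fin n => i < j),
        (if σ i then (1 : ℝ) else -1) * (if σ j then (1 : ℝ) else -1)) = gibbsWeight σ := by
    intro σ
    have h := sum_lt_mul_eq (fun i => spin (σ i)) fun i => spin_sq (σ i)
    simp only [spin] at h
    rw [h]
    rfl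
  have hS : ∀ σ : Fin n → Bool, ∑ i : Fin n, (if σ i then (1 : ℝ) else -1) = magnetization σ :=
    fun σ => rfl
  simp only [hw, hS]
  have hZ : 0 < ∑ σ : Fin n → Bool, gibbsWeight σ :=
    sum_pos (fun σ _ => Real.exp_pos _) univ_nonempty
  have h6 := sum_gibbsWeight_mul_pow_six_le hn
  refine ⟨(div_le_iff₀ hZ).2 h6, (div_le_iff₀ hZ).2 ?_⟩
  have hpt : ∀ σ : Fin n → Bool,
      gibbsWeight σ * |(n : ℝ) ^ (-(3 : ℝ) / 4) * magnetization σ| ^ 3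
        ≤ gibbsWeight σ * ((n : ℝ) ^ (-(3 : ℝ) / 4) * magnetization σ) ^ 6 * (1 / 30)
          + gibbsWeight σ * (15 / 2) := by
    intro σ
    set x := (n : ℝ) ^ (-(3 : ℝ) / 4) * magnetization σ
    have hx : x ^ 6 = (|x| ^ 3) ^ 2 := by
      rw [← pow_mul, (by decide : Even (3 * 2)).pow_abs]
    have hle : |x| ^ 3 ≤ x ^ 6 * (1 / 30) + 15 / 2 := by
      rw [hx]
      nlinarith [sq_nonneg (|x| ^ 3 - 15)]
    have := mul_le_mul_of_nonneg_left hle (show 0 < gibbsWeight σ from Real.exp_pos _).le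
    linarith
  have h := sum_le_sum fun (σ : Fin n → Bool) (_ : σ ∈ univ) => hpt σ
  rw [sum_add_distrib, ← sum_mul, ← sum_mul] at h
  linarith
end

section
/- Let Y have the exponential distribution with mean 1 and let h: [0,∞) → ℝ be measurable with E|h(Y)| < ∞. Define f_h(w) = e^{w} ∫₀^{w} (h(t) − E h(Y)) e^{−t} dt for w ≥ 0. Then: (1) if h is bounded, |f_h(w)| ≤ 3 ‖h‖ w for all w ≥ 0; (2) if h is absolutely continuous with bounded derivative h', then |f_h(w)| ≤ 3 ‖h'‖ w for all w ≥ 0. In particular |f_h(w)| ≤ 3 min(‖h‖, ‖h'‖) w whenever both norms are finite. -/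
open MeasureTheory

/-- An affine function times `e^{-t}` has antiderivative `-(a + b + b t) e^{-t}`. -/
lemma hasDerivAt_neg_affine_mul_exp_neg (a b x : ℝ) :
    HasDerivAt (fun t => -((a + b + b * t) * Real.exp (-t)))
      ((a + b * x) * Real.exp (-x)) x := by
  have h1 : HasDerivAt (fun t : ℝ => a + b + b * t) (b * 1) x :=
    ((hasDerivAt_id x).const_mul b).const_add (a + b)
  have h2 : HasDerivAt (fun t : ℝ => Real.exp (-t)) (Real.exp (-x) * (-1)) x :=
    (hasDerivAt_neg x).exp
  exact (h1.mul h2).neg.congr_deriv (by ring)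

lemma tendsto_neg_affine_mul_exp_neg (a b : ℝ) :
    Filter.Tendsto (fun t => -((a + b + b * t) * Real.exp (-t))) Filter.atTop (nhds 0) := by
  have h0 := Real.tendsto_pow_mul_exp_neg_atTop_nhds_zero 0
  have h1 := Real.tendsto_pow_mul_exp_neg_atTop_nhds_zero 1
  have h := ((h0.const_mul (a + b)).add (h1.const_mul b)).neg
  simp only [mul_zero, add_zero, neg_zero] at h
  refine h.congr fun t => ?_
  ring

lemma integrableOn_affine_mul_exp_neg {a b w : ℝ} (ha : 0 ≤ a) (hb : 0 ≤ b) (hw : 0 ≤ w) :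
    IntegrableOn (fun t => (a + b * t) * Real.exp (-t)) (Set.Ioi w) := by
  refine integrableOn_Ioi_deriv_of_nonneg' (fun x _ => hasDerivAt_neg_affine_mul_exp_neg a b x)
    (fun x hx => ?_) (tendsto_neg_affine_mul_exp_neg a b)
  have : 0 ≤ x := hw.trans (le_of_lt hx)
  positivity

lemma setIntegral_Ioi_affine_mul_exp_neg {a b w : ℝ} (ha : 0 ≤ a) (hb : 0 ≤ b) (hw : 0 ≤ w) :
    ∫ t in Set.Ioi w, (a + b * t) * Real.exp (-t) = (a + b + b * w) * Real.exp (-w) := by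
  rw [integral_Ioi_of_hasDerivAt_of_tendsto' (fun x _ => hasDerivAt_neg_affine_mul_exp_neg a b x)
    (integrableOn_affine_mul_exp_neg ha hb hw) (tendsto_neg_affine_mul_exp_neg a b)]
  ring

lemma abs_setIntegral_mul_exp_neg_le {g : ℝ → ℝ} {a b : ℝ} {s : Set ℝ} (ha : 0 ≤ a) (hb : 0 ≤ b)
    (hs : MeasurableSet s) (hs0 : s ⊆ Set.Ioi 0) (hg : ∀ t, 0 ≤ t → |g t| ≤ a + b * t) :
    |∫ t in s, g t * Real.exp (-t)| ≤ ∫ t in s, (a + b * t) * Real.exp (-t) := by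
  rw [← Real.norm_eq_abs]
  refine norm_integral_le_of_norm_le
    ((integrableOn_affine_mul_exp_neg ha hb le_rfl).mono_set hs0) ?_
  filter_upwards [ae_restrict_mem hs] with t ht
  rw [norm_mul, Real.norm_eq_abs, Real.norm_eq_abs, Real.abs_exp]
  exact mul_le_mul_of_nonneg_right (hg t (le_of_lt (hs0 ht))) (Real.exp_pos _).le

lemma setIntegral_Ioc_add_Ioi {f : ℝ → ℝ} {w : ℝ} (hw : 0 ≤ w)
    (hf : IntegrableOn f (Set.Ioi (0 : ℝ))) :
    (∫ t in Set.Ioc 0 w, f t) + ∫ t in Set.Ioi w, f t = ∫ t in Set.Ioi 0, f t := by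
  rw [← setIntegral_union (Set.Ioc_disjoint_Ioi le_rfl) measurableSet_Ioi
    (hf.mono_set Set.Ioc_subset_Ioi_self) (hf.mono_set (Set.Ioi_subset_Ioi hw)),
    Set.Ioc_union_Ioi_eq_Ioi hw]

/-- The two bounds on `e^w ∫₀^w g(t) e^{-t} dt`, for centred `g` of at most affine growth, obtained
by integrating over `(0, w]` and over `(w, ∞)`. -/
lemma abs_exp_mul_setIntegral_le {g : ℝ → ℝ} {a b w : ℝ} (ha : 0 ≤ a) (hb : 0 ≤ b) (hw : 0 ≤ w)
    (hg : ∀ t, 0 ≤ t → |g t| ≤ a + b * t)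
    (hint : IntegrableOn (fun t => g t * Real.exp (-t)) (Set.Ioi (0 : ℝ)))
    (hmean : ∫ t in Set.Ioi (0 : ℝ), g t * Real.exp (-t) = 0) :
    |Real.exp w * ∫ t in Set.Ioc 0 w, g t * Real.exp (-t)| ≤
        (a + b) * (Real.exp w - 1) - b * w ∧
      |Real.exp w * ∫ t in Set.Ioc 0 w, g t * Real.exp (-t)| ≤ a + b + b * w := by
  have hexp : Real.exp w * Real.exp (-w) = 1 := by rw [← Real.exp_add]; simp
  rw [abs_mul, Real.abs_exp]
  constructor
  · have h1 := abs_setIntegral_mul_exp_neg_le ha hb measurableSet_Ioc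
      (Set.Ioc_subset_Ioi_self : Set.Ioc 0 w ⊆ Set.Ioi 0) hg
    have h2 := setIntegral_Ioc_add_Ioi hw (integrableOn_affine_mul_exp_neg ha hb le_rfl)
    rw [setIntegral_Ioi_affine_mul_exp_neg ha hb hw,
      setIntegral_Ioi_affine_mul_exp_neg ha hb le_rfl] at h2
    simp only [mul_zero, add_zero, neg_zero, Real.exp_zero, mul_one] at h2
    rw [eq_sub_of_add_eq h2] at h1
    refine (mul_le_mul_of_nonneg_left h1 (Real.exp_pos w).le).trans_eq ?_
    linear_combination (-(a + b + b * w)) * hexp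
  · have h1 := abs_setIntegral_mul_exp_neg_le ha hb measurableSet_Ioi (Set.Ioi_subset_Ioi hw) hg
    have h2 := setIntegral_Ioc_add_Ioi hw hint
    rw [hmean] at h2
    rw [eq_neg_of_add_eq_zero_left h2, abs_neg]
    rw [setIntegral_Ioi_affine_mul_exp_neg ha hb hw] at h1
    refine (mul_le_mul_of_nonneg_left h1 (Real.exp_pos w).le).trans_eq ?_
    linear_combination (a + b + b * w) * hexp

lemma integrableOn_exp_neg_Ioi_zero :
    IntegrableOn (fun t => Real.exp (-t)) (Set.Ioi (0 : ℝ)) := by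
  simpa using integrableOn_affine_mul_exp_neg zero_le_one le_rfl (le_refl (0 : ℝ))

lemma integrableOn_sub_const_mul_exp_neg {h : ℝ → ℝ}
    (hint : IntegrableOn (fun t => h t * Real.exp (-t)) (Set.Ioi (0 : ℝ))) (c : ℝ) :
    IntegrableOn (fun t => (h t - c) * Real.exp (-t)) (Set.Ioi (0 : ℝ)) := by
  simp only [sub_mul]
  exact hint.sub (integrableOn_exp_neg_Ioi_zero.const_mul c)

lemma setIntegral_sub_const_mul_exp_neg {h : ℝ → ℝ}
    (hint : IntegrableOn (fun t => h t * Real.exp (-t)) (Set.Ioi (0 : ℝ))) (c : ℝ) :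
    ∫ t in Set.Ioi (0 : ℝ), (h t - c) * Real.exp (-t) =
      (∫ t in Set.Ioi (0 : ℝ), h t * Real.exp (-t)) - c := by
  simp only [sub_mul]
  rw [integral_sub hint (integrableOn_exp_neg_Ioi_zero.const_mul c), integral_const_mul,
    integral_exp_neg_Ioi_zero, mul_one]

lemma exp_le_one_add_three_halves_mul {w : ℝ} (hw : 0 ≤ w) (hw' : w ≤ 2 / 3) :
    Real.exp w ≤ 1 + 3 / 2 * w := by
  have h := Real.exp_bound' hw (by linarith) (n := 3) (by norm_num)
  norm_num [Finset.sum_range_succ, Nat.factorial] at h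
  nlinarith [mul_nonneg hw (sub_nonneg.2 hw'), mul_nonneg (mul_nonneg hw hw) (sub_nonneg.2 hw')]

lemma exp_le_one_add_two_mul {w : ℝ} (hw : 0 ≤ w) (hw' : w ≤ 1) :
    Real.exp w ≤ 1 + 2 * w := by
  have h := (abs_le.1 (Real.abs_exp_sub_one_sub_id_le (abs_le.2 ⟨by linarith, hw'⟩))).2
  nlinarith



/-- **Bounds on the Stein solution for the exponential distribution** (proof of Theorem 3.1):
with Y exponential of mean 1 (density e^{-t} on (0,∞)) and
f_h(w) = e^w ∫₀^w (h(t) - E h(Y)) e^{-t} dt, one has |f_h(w)| ≤ 3‖h‖w for bounded h and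
|f_h(w)| ≤ 3‖h'‖w for absolutely continuous h with bounded derivative h', for all w ≥ 0. -/
theorem exponential_stein_solution_bound
    (h h' : ℝ → ℝ) (hhmeas : Measurable h)
    -- E|h(Y)| < ∞
    (hhInt : IntegrableOn (fun t => h t * Real.exp (-t)) (Set.Ioi (0 : ℝ))) :
    -- (1) bounded h: |f_h(w)| ≤ 3 ‖h‖ w for w ≥ 0
    ((∀ H : ℝ, (∀ x : ℝ, 0 ≤ x → |h x| ≤ H) →
      ∀ w : ℝ, 0 ≤ w →
        |Real.exp w * ∫ t in Set.Ioc (0 : ℝ) w,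
            (h t - ∫ u in Set.Ioi (0 : ℝ), h u * Real.exp (-u)) * Real.exp (-t)|
          ≤ 3 * H * w))
    -- (2) absolutely continuous h with |h'| ≤ H': |f_h(w)| ≤ 3 ‖h'‖ w for w ≥ 0
    ∧ ∀ H' : ℝ,
        (∀ x : ℝ, 0 ≤ x → ∀ y : ℝ, 0 ≤ y → h y - h x = ∫ t in x..y, h' t) →
        (∀ x : ℝ, 0 ≤ x → |h' x| ≤ H') →
      ∀ w : ℝ, 0 ≤ w →
        |Real.exp w * ∫ t in Set.Ioc (0 : ℝ) w,
            (h t - ∫ u in Set.Ioi (0 : ℝ), h u * Real.exp (-u)) * Real.exp (-t)|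
          ≤ 3 * H' * w := by
  set m := ∫ u in Set.Ioi (0 : ℝ), h u * Real.exp (-u) with hm
  have hint := integrableOn_sub_const_mul_exp_neg hhInt m
  have hmean : ∫ t in Set.Ioi (0 : ℝ), (h t - m) * Real.exp (-t) = 0 := by
    rw [setIntegral_sub_const_mul_exp_neg hhInt, sub_self]
  refine ⟨fun H hH w hw => ?_, fun H' hac hH' w hw => ?_⟩
  · have hH0 : 0 ≤ H := (abs_nonneg _).trans (hH 0 le_rfl)
    have hmH : |m| ≤ H := by
      have h1 := abs_setIntegral_mul_exp_neg_le hH0 le_rfl measurableSet_Ioi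
        (subset_refl (Set.Ioi (0 : ℝ))) (g := h) (by simpa using hH)
      rw [setIntegral_Ioi_affine_mul_exp_neg hH0 le_rfl le_rfl] at h1
      simpa using h1
    obtain ⟨h1, h2⟩ := abs_exp_mul_setIntegral_le (a := 2 * H) (b := 0) (by positivity) le_rfl hw
      (fun t ht => by linarith [abs_sub (h t) m, hH t ht]) hint hmean
    rcases le_total w (2 / 3) with hw' | hw'
    · nlinarith [exp_le_one_add_three_halves_mul hw hw']
    · nlinarith
  · have hH0 : 0 ≤ H' := (abs_nonneg _).trans (hH' 0 le_rfl)
    have hlip : ∀ x, 0 ≤ x → ∀ y, 0 ≤ y → |h y - h x| ≤ H' * |y - x| := by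
      intro x hx y hy
      rw [hac x hx y hy, ← Real.norm_eq_abs]
      refine intervalIntegral.norm_integral_le_of_norm_le_const fun t ht => ?_
      exact hH' t ((le_min hx hy).trans (le_of_lt ht.1))
    have hg : ∀ t, 0 ≤ t → |h t - m| ≤ H' + H' * t := by
      intro t ht
      have h1 := abs_setIntegral_mul_exp_neg_le (a := H' * t) (b := H') (by positivity) hH0
        measurableSet_Ioi (subset_refl (Set.Ioi (0 : ℝ))) (g := fun u => h u - h t) fun u hu => by
          have h3 : |u - t| ≤ t + u := abs_le.2 ⟨by linarith, by linarith⟩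
          nlinarith [hlip t ht u hu]
      rw [setIntegral_Ioi_affine_mul_exp_neg (by positivity) hH0 le_rfl,
        setIntegral_sub_const_mul_exp_neg hhInt, ← hm, abs_sub_comm] at h1
      simp only [mul_zero, add_zero, neg_zero, Real.exp_zero, mul_one] at h1
      linarith
    obtain ⟨h1, h2⟩ := abs_exp_mul_setIntegral_le hH0 hH0 hw hg hint hmean
    rcases le_total w 1 with hw' | hw'
    · nlinarith [exp_le_one_add_two_mul hw hw']
    · nlinarith
end

section
/- Let g: ℝ → ℝ be differentiable and non-decreasing with g(t) ≥ 0 for t > 0 and g(t) ≤ 0 for t ≤ 0, let c₀ > 0, c₁ = 1/∫_{−∞}^{∞} e^{−c₀ ∫₀ᵗ g(s) ds} dt (assumed finite and positive), and suppose there is c₃ < ∞ with min(1/c₁, 1/|c₀ g(x)|)·(|x| + 3/c₁)·c₀|g'(x)| ≤ c₃ for all x. Then |g'(x)| ≤ (c₁ c₃/(3 c₀))·(c₁ + c₀ |g(x)|) for all x, and if δ > 0 satisfies c₁ c₃ δ ≤ 1, then for every w ∈ ℝ, sup_{|t| ≤ δ} |g(w + t) − g(w)| ≤ (c₁ c₃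 δ/(2 c₀))·(c₁ + c₀ |g(w)|). -/
open MeasureTheory

/-- **Local Lipschitz estimate for g** (key step (5.12)–(5.13) in the proof of the
Berry–Esseen bound): under (H1) and (H3), |g'(x)| ≤ (c₁c₃/(3c₀))(c₁ + c₀|g(x)|), and if
c₁c₃δ ≤ 1 with δ > 0, then sup_{|t|≤δ} |g(w+t) - g(w)| ≤ (c₁c₃δ/(2c₀))(c₁ + c₀|g(w)|). -/
theorem g_local_lipschitz_estimate
    (g g' : ℝ → ℝ) (hg' : ∀ x, HasDerivAt g (g' x) x)
    -- (H1)
    (hmono : Monotone g) (hgpos : ∀ t, 0 < t → 0 ≤ g t) (hgneg : ∀ t, t ≤ 0 → g t ≤ 0)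
    (c₀ c₁ c₃ : ℝ) (hc₀ : 0 < c₀) (hc₁pos : 0 < c₁)
    (hpInt : Integrable (fun t => Real.exp (-(c₀ * ∫ s in (0:ℝ)..t, g s))))
    (hc₁ : c₁ = (∫ t : ℝ, Real.exp (-(c₀ * ∫ s in (0:ℝ)..t, g s)))⁻¹)
    -- (H3), with 1/|c₀ g(x)| read as +∞ when g(x) = 0
    (hH3 : ∀ x, (if g x = 0 then 1 / c₁ else min (1 / c₁) (1 / |c₀ * g x|))
        * (|x| + 3 / c₁) * (c₀ * |g' x|) ≤ c₃) :
    (∀ x : ℝ, |g' x| ≤ c₁ * c₃ / (3 * c₀) * (c₁ + c₀ * |g x|))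
    ∧ ∀ δ : ℝ, 0 < δ → c₁ * c₃ * δ ≤ 1 →
        ∀ w t : ℝ, |t| ≤ δ →
          |g (w + t) - g w| ≤ c₁ * c₃ * δ / (2 * c₀) * (c₁ + c₀ * |g w|) := by
  have hderiv : ∀ x : ℝ, |g' x| ≤ c₁ * c₃ / (3 * c₀) * (c₁ + c₀ * |g x|) := by
    intro x
    have ha : |c₀ * g x| = c₀ * |g x| := by rw [abs_mul, abs_of_pos hc₀]
    have hS : 0 < c₁ + c₀ * |g x| := by positivity
    have hmin : 1 / (c₁ + c₀ * |g x|) ≤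
        if g x = 0 then 1 / c₁ else min (1 / c₁) (1 / |c₀ * g x|) := by
      split_ifs with h
      · simp [h]
      · have hg : 0 < |g x| := abs_pos.mpr h
        rw [ha]
        refine le_min ?_ ?_
        · exact one_div_le_one_div_of_le hc₁pos (by nlinarith)
        · exact one_div_le_one_div_of_le (by positivity) (by linarith)
    have hle : 1 / (c₁ + c₀ * |g x|) * (3 / c₁) * (c₀ * |g' x|) ≤ c₃ := by
      refine le_trans ?_ (hH3 x)
      have hpos : 0 ≤ 1 / (c₁ + c₀ * |g x|) := by positivity
      have hx : 3 / c₁ ≤ |x| + 3 / c₁ := le_add_of_nonneg_left (abs_nonneg x)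
      exact mul_le_mul_of_nonneg_right
        (mul_le_mul hmin hx (by positivity) (hpos.trans hmin)) (by positivity)
    calc |g' x| = 1 / (c₁ + c₀ * |g x|) * (3 / c₁) * (c₀ * |g' x|)
          * (c₁ / (3 * c₀) * (c₁ + c₀ * |g x|)) := by field_simp
      _ ≤ c₃ * (c₁ / (3 * c₀) * (c₁ + c₀ * |g x|)) :=
          mul_le_mul_of_nonneg_right hle (by positivity)
      _ = c₁ * c₃ / (3 * c₀) * (c₁ + c₀ * |g x|) := by ring
  refine ⟨hderiv, ?_⟩
  intro δ hδ hδ1 w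
  have hK : 0 ≤ c₁ * c₃ / (3 * c₀) :=
    nonneg_of_mul_nonneg_left ((abs_nonneg _).trans (hderiv 0)) (by positivity)
  obtain ⟨M, hM⟩ : ∃ M, M = max (g (w + δ) - g w) (g w - g (w - δ)) := ⟨_, rfl⟩
  have hosc : ∀ y ∈ Set.Icc (w - δ) (w + δ), |g y - g w| ≤ M := by
    intro y hy
    have h1 := hmono hy.1
    have h2 := hmono hy.2
    have h3 : g (w + δ) - g w ≤ M := hM ▸ le_max_left _ _
    have h4 : g w - g (w - δ) ≤ M := hM ▸ le_max_right _ _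
    exact abs_le.mpr ⟨by linarith, by linarith⟩
  have hw : w ∈ Set.Icc (w - δ) (w + δ) := ⟨by linarith, by linarith⟩
  have hM0 : 0 ≤ M := (abs_nonneg _).trans (hosc w hw)
  have hbound : ∀ y ∈ Set.Icc (w - δ) (w + δ),
      ‖g' y‖ ≤ c₁ * c₃ / (3 * c₀) * (c₁ + c₀ * (|g w| + M)) := by
    intro y hy
    refine (hderiv y).trans (mul_le_mul_of_nonneg_left ?_ hK)
    have h1 : |g y| ≤ |g w| + M := by
      have := abs_sub_abs_le_abs_sub (g y) (g w)
      linarith [hosc y hy]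
    gcongr
  have hmv : ∀ y ∈ Set.Icc (w - δ) (w + δ),
      |g y - g w| ≤ c₁ * c₃ / (3 * c₀) * (c₁ + c₀ * (|g w| + M)) * δ := by
    intro y hy
    have h1 := (convex_Icc (w - δ) (w + δ)).norm_image_sub_le_of_norm_hasDerivWithin_le
      (fun z _ => (hg' z).hasDerivWithinAt) hbound hw hy
    refine h1.trans (mul_le_mul_of_nonneg_left ?_ (by positivity))
    rw [Real.norm_eq_abs]
    exact abs_le.mpr ⟨by linarith [hy.1], by linarith [hy.2]⟩
  have hMle : M ≤ c₁ * c₃ / (3 * c₀) * (c₁ + c₀ * (|g w| + M)) * δ := by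
    have h1 := (le_abs_self _).trans (hmv (w + δ) ⟨by linarith, le_rfl⟩)
    have h2 := (neg_le_abs _).trans (hmv (w - δ) ⟨le_rfl, by linarith⟩)
    rw [neg_sub] at h2
    exact hM.le.trans (max_le h1 h2)
  have hfinal : M ≤ c₁ * c₃ * δ / (2 * c₀) * (c₁ + c₀ * |g w|) := by
    have h1 : c₁ * c₃ / (3 * c₀) * (c₁ + c₀ * (|g w| + M)) * δ
        = 2 / 3 * (c₁ * c₃ * δ / (2 * c₀) * (c₁ + c₀ * |g w|)) + c₁ * c₃ * δ * M / 3 := by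
      field_simp
      ring
    have h2 : c₁ * c₃ * δ * M ≤ 1 * M := mul_le_mul_of_nonneg_right hδ1 hM0
    linarith
  intro t ht
  obtain ⟨ht1, ht2⟩ := abs_le.mp ht
  exact (hosc (w + t) ⟨by linarith, by linarith⟩).trans hfinal
end
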